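/- arXiv:0903.0369 — 4 statements merged into one kernel-verified Lean document; each statement's English description precedes it below -/
import Mathlib

section
/- Let f be a homeomorphism of the open unit disk 𝔻, let X ⊆ 𝔻 be a free path-connected subset, and suppose there exist z ∈ 𝔻 and integers k < m such that f^k(z) ∈ X and f^m(z) ∈ X. Then f is recurrent. (Claim established in the proof of Lemma 7.5: a free set containing two points of the same orbit forces recurrence.) -/
open Set Filter Metric Topology

noncomputable section

/-- The open unit disk in the complex plane. -/
abbrev Disk : Set ℂ := Metric.ball 0 1

/-- The `k`-th iterate (`k ∈ ℤ`) of a homeomorphism of the open unit disk. -/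
def fiter (f : ↥Disk ≃ₜ ↥Disk) (k : ℤ) : ↥Disk → ↥Disk := fun z => (f.toEquiv ^ k) z

/-- A subset `X` of the disk is free for `f` if `f(X) ∩ X = ∅`. -/
def IsFreeSet (f : ↥Disk ≃ₜ ↥Disk) (X : Set ↥Disk) : Prop := (⇑f '' X) ∩ X = ∅

/-- An open disk: an open subset of `Disk` homeomorphic to `Disk`. -/
def IsOpenDisk (U : Set ↥Disk) : Prop := IsOpen U ∧ Nonempty (↥U ≃ₜ ↥Disk)

/-- `f` is recurrent: there is a closed chain of pairwise disjoint free open disks. -/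
def RecurrentHomeo (f : ↥Disk ≃ₜ ↥Disk) : Prop :=
  ∃ r : ℕ, 1 ≤ r ∧ ∃ X : ZMod r → Set ↥Disk,
    (∀ i, IsOpenDisk (X i)) ∧ (∀ i, IsFreeSet f (X i)) ∧
    (Pairwise fun i j => Disjoint (X i) (X j)) ∧
    (∀ i, ∃ k : ℤ, 1 ≤ k ∧ ((fiter f k '' X i) ∩ X (i + 1)).Nonempty)

/-- A small push: a homeomorphism of the plane supported in a ball, moving the centre to `b`. -/
lemma exists_push (a b : ℂ) (ρ : ℝ) (h : dist a b < ρ) :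
    ∃ g : ℂ ≃ₜ ℂ, g a = b ∧ ∀ x, x ∉ ball a ρ → g x = x := by
  have hρ : 0 < ρ := lt_of_le_of_lt dist_nonneg h
  let φ : ℂ → ℂ := fun x => x + (max 0 (1 - dist x a / ρ) : ℝ) • (b - a)
  have hc0 : 0 ≤ dist a b / ρ := by positivity
  let c : NNReal := ⟨dist a b / ρ, hc0⟩
  have hφ : ApproximatesLinearOn φ ((ContinuousLinearEquiv.refl ℝ ℂ : ℂ ≃L[ℝ] ℂ) : ℂ →L[ℝ] ℂ)
      univ c := by
    intro x _ y _
    have e : φ x - φ y - ((ContinuousLinearEquiv.refl ℝ ℂ : ℂ ≃L[ℝ] ℂ) : ℂ →L[ℝ] ℂ) (x - y)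
        = (max 0 (1 - dist x a / ρ) - max 0 (1 - dist y a / ρ) : ℝ) • (b - a) := by
      simp only [φ, ContinuousLinearEquiv.coe_coe, ContinuousLinearEquiv.coe_refl', id]
      rw [sub_smul]; ring
    rw [e, norm_smul]
    have h1 : ‖(max 0 (1 - dist x a / ρ) - max 0 (1 - dist y a / ρ) : ℝ)‖ ≤ ‖x - y‖ / ρ := by
      have h2 : |max (0:ℝ) (1 - dist x a / ρ) - max 0 (1 - dist y a / ρ)|
          ≤ |(1 - dist x a / ρ) - (1 - dist y a / ρ)| := by
        have := abs_max_sub_max_le_abs (1 - dist x a / ρ) (1 - dist y a / ρ) 0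
        rwa [max_comm, max_comm (1 - dist y a / ρ)] at this
      have h3 : (1 - dist x a / ρ) - (1 - dist y a / ρ) = (dist y a - dist x a) / ρ := by ring
      rw [Real.norm_eq_abs]
      refine h2.trans ?_
      rw [h3, abs_div, abs_of_pos hρ]
      gcongr
      have := abs_dist_sub_le y x a
      rwa [dist_comm y x, dist_eq_norm x y] at this
    have h4 : ‖b - a‖ = dist a b := by rw [dist_comm, dist_eq_norm]
    calc _ ≤ ‖x - y‖ / ρ * ‖b - a‖ := by gcongr
      _ = (dist a b / ρ) * ‖x - y‖ := by rw [h4]; ring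
  have hc : Subsingleton ℂ ∨
      c < ‖((ContinuousLinearEquiv.refl ℝ ℂ).symm : ℂ →L[ℝ] ℂ)‖₊⁻¹ := by
    right
    have : ‖((ContinuousLinearEquiv.refl ℝ ℂ).symm : ℂ →L[ℝ] ℂ)‖₊ = 1 := by
      have := ContinuousLinearMap.nnnorm_id (𝕜 := ℝ) (E := ℂ)
      simpa using this
    rw [this, inv_one]
    change dist a b / ρ < 1
    rwa [div_lt_one hρ]
  have hv : ∀ x, hφ.toHomeomorph φ hc x = φ x := fun x => rfl
  refine ⟨hφ.toHomeomorph φ hc, ?_, ?_⟩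
  · rw [hv]; simp [φ]
  · intro x hx
    rw [hv]
    have : 1 - dist x a / ρ ≤ 0 := by
      rw [mem_ball, not_lt] at hx
      have := (one_le_div hρ).2 hx
      linarith
    simp only [φ, max_eq_left this, zero_smul, add_zero]

/-- An open subset of the plane homeomorphic to the disk, inside `W`, containing `p` and `q`. -/
def Linked (W : Set ℂ) (p q : ℂ) : Prop :=
  ∃ D : Set ℂ, IsOpen D ∧ D ⊆ W ∧ p ∈ D ∧ q ∈ D ∧ Nonempty (↥D ≃ₜ ↥Disk)

lemma ball_disk (p : ℂ) (ε : ℝ) (hε : 0 < ε) : Nonempty (↥(ball p ε) ≃ₜ ↥Disk) := by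
  let e : ℂ ≃ₜ ℂ := (Homeomorph.mulLeft₀ (ε : ℂ) (by exact_mod_cast hε.ne')).trans
    (Homeomorph.addLeft p)
  have he : e '' Disk = ball p ε := by
    have h1 : e ⁻¹' (ball p ε) = Disk := by
      ext x
      simp [e, dist_eq_norm, abs_of_pos hε, hε]
    rw [← h1, image_preimage_eq _ e.surjective]
  exact ⟨((e.image Disk).trans (Homeomorph.setCongr he)).symm⟩

lemma linked_of_connected (W : Set ℂ) (hW : IsOpen W) (K : Set ℂ) (hK : IsPreconnected K)
    (hKW : K ⊆ W) (p : ℂ) (hp : p ∈ K) : ∀ q ∈ K, Linked W p q := by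
  have hpp : Linked W p p := by
    obtain ⟨ε, hε, hb⟩ := Metric.isOpen_iff.1 hW p (hKW hp)
    exact ⟨ball p ε, isOpen_ball, hb, mem_ball_self hε, mem_ball_self hε, ball_disk p ε hε⟩
  have hopen : IsOpen {q | Linked W p q} := by
    rw [isOpen_iff_mem_nhds]
    rintro q ⟨D, hD, h1, h2, h3, h4⟩
    exact mem_of_superset (hD.mem_nhds h3) fun x hx => ⟨D, hD, h1, h2, hx, h4⟩
  refine hK.subset_of_closure_inter_subset hopen ⟨p, hp, hpp⟩ ?_
  rintro q ⟨hq, hqK⟩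
  by_cases hpq : q = p
  · subst hpq; exact hpp
  have hW' : IsOpen (W \ {p}) := hW.sdiff isClosed_singleton
  obtain ⟨ε, hε, hb⟩ := Metric.isOpen_iff.1 hW' q ⟨hKW hqK, hpq⟩
  obtain ⟨a, ⟨D, hD, h1, h2, h3, ⟨h4⟩⟩, ha⟩ := Metric.mem_closure_iff.1 hq (ε / 2) (by linarith)
  have hsub : ball a (ε / 2) ⊆ ball q ε := by
    apply ball_subset_ball'
    rw [dist_comm]; linarith
  obtain ⟨g, hg, hfix⟩ := exists_push a q (ε / 2) (by rwa [dist_comm])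
  refine ⟨g '' D, g.isOpenMap _ hD, ?_, ⟨p, h2, ?_⟩, ⟨a, h3, hg⟩, ⟨(g.image D).symm.trans h4⟩⟩
  · rintro _ ⟨x, hx, rfl⟩
    by_cases hx' : g x ∈ ball a (ε / 2)
    · exact (hb (hsub hx')).1
    · have := g.injective (hfix _ hx')
      rw [this]; exact h1 hx
  · exact hfix p fun h => (hb (hsub h)).2 rfl

/-- A free path-connected set containing two points of the same orbit forces
recurrence (claim established in the proof of Lemma 7.5). -/
theorem handel_free_two_orbit_points (f : ↥Disk ≃ₜ ↥Disk)
    (X : Set ↥Disk) (hfree : IsFreeSet f X) (hpath : IsPathConnected X)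
    (z : ↥Disk) (k m : ℤ) (hkm : k < m)
    (hk : fiter f k z ∈ X) (hm : fiter f m z ∈ X) :
    RecurrentHomeo f := by
  obtain ⟨γ, hγ⟩ := hpath.joinedIn _ hk _ hm
  have hKc : IsCompact (range γ) := isCompact_range γ.continuous
  have hdisj : Disjoint (range γ) (f '' range γ) := by
    rw [Set.disjoint_left]
    rintro _ ⟨t, rfl⟩ ⟨_, ⟨s, rfl⟩, h⟩
    have : γ t ∈ f '' X ∩ X := ⟨⟨γ s, hγ s, h⟩, hγ t⟩
    rw [hfree] at this
    exact this
  obtain ⟨V₁, V₂, hV₁, hV₂, hK₁, hK₂, hV⟩ :=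
    SeparatedNhds.of_isCompact_isCompact hKc (hKc.image f.continuous) hdisj
  have hWo : IsOpen (V₁ ∩ f ⁻¹' V₂) := hV₁.inter (hV₂.preimage f.continuous)
  have hDo : IsOpen Disk := isOpen_ball
  have hW : IsOpen ((↑) '' (V₁ ∩ f ⁻¹' V₂) : Set ℂ) := hDo.isOpenMap_subtype_val _ hWo
  have hKW : range γ ⊆ V₁ ∩ f ⁻¹' V₂ := fun x hx => ⟨hK₁ hx, hK₂ ⟨x, hx, rfl⟩⟩
  have hconn : IsPreconnected ((↑) '' range γ : Set ℂ) :=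
    (isPreconnected_range γ.continuous).image _ continuous_subtype_val.continuousOn
  obtain ⟨D, hD, hDW, hp, hq, ⟨e⟩⟩ := linked_of_connected _ hW _ hconn (image_mono hKW)
    (fiter f k z : ℂ) ⟨_, ⟨0, γ.source⟩, rfl⟩ (fiter f m z : ℂ) ⟨_, ⟨1, γ.target⟩, rfl⟩
  have hsub : ∀ x : ↥Disk, (x : ℂ) ∈ D → x ∈ V₁ ∩ f ⁻¹' V₂ := by
    intro x hx
    obtain ⟨y, hy, hxy⟩ := hDW hx
    rwa [← Subtype.ext hxy]
  have hDD : (Subtype.val : ↥Disk → ℂ) '' (Subtype.val ⁻¹' D) = D := by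
    rw [Subtype.image_preimage_coe, inter_eq_right]
    intro x hx
    obtain ⟨y, hy, rfl⟩ := hDW hx
    exact y.2
  refine ⟨1, le_rfl, fun _ => Subtype.val ⁻¹' D, fun _ => ⟨hD.preimage continuous_subtype_val, ?_⟩,
    fun _ => ?_, fun i j hij => absurd (Subsingleton.elim i j) hij, fun _ => ⟨m - k, by omega, ?_⟩⟩
  · exact ⟨((Topology.IsEmbedding.subtypeVal.homeomorphImage _).trans
      (Homeomorph.setCongr hDD)).trans e⟩
  · rw [IsFreeSet, Set.eq_empty_iff_forall_notMem]
    rintro _ ⟨⟨x, hx, rfl⟩, hy⟩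
    exact Set.disjoint_left.1 hV (hsub _ hy).1 (hsub _ hx).2
  · refine ⟨fiter f m z, ⟨fiter f k z, hp, ?_⟩, hq⟩
    simp only [fiter]
    rw [← Equiv.Perm.mul_apply, ← zpow_add, sub_add_cancel]
end
end

section
/- Let f be a homeomorphism of the open unit disk 𝔻, let z ∈ 𝔻 and let α, ω be two distinct points of S¹ with f^k(z) → α as k → −∞ and f^k(z) → ω as k → +∞, and suppose that f extends to a homeomorphism of 𝔻 ∪ {α, ω} (with its topology as a subspace of ℂ). Suppose given a sequence (D^k)_{k∈ℤ} of pairwise disjoint closed disks in 𝔻 such that for every k ∈ ℤ: f^k(z) ∈ Int(D^k); D^k ∩ Fix(f) = ∅; f(D^k) ∩ D^k ≠ ∅; f(D^k) ∩ D^{k'} = ∅ and f²(D^k) ∩ D^{k'} = ∅ for every k' < k; and (D^k) converges to {α} as k → −∞ and to {ω} as k → +∞. Then at least one of the following holds: (i) f is recurrent; (ii) there exists a sequence (γ^k)_{k∈ℤ} of segments such that each γ^k is a translation arc for f joining f^k(z) to f^{k+1}(z), f(γ^k) ∩ γ^{k'} = ∅ whenever k' < k, the sequence (γ^k)_{k≤0}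 converges to {α} as k → −∞, and the sequence (γ^k)_{k≥0} converges to {ω} as k → +∞. (Proposition 3.1, derived from the conclusion of Lemma 3.4.) -/
open Set Filter Metric Topology

noncomputable section

/-- `γ` is a segment of the disk joining `a` to `b`: the image of an injective
continuous map defined on `[0,1]` sending `0` to `a` and `1` to `b`. -/
def IsSegment (γ : Set ↥Disk) (a b : ↥Disk) : Prop :=
  ∃ g : ℝ → ↥Disk, ContinuousOn g (Set.Icc 0 1) ∧ Set.InjOn g (Set.Icc 0 1) ∧
    g 0 = a ∧ g 1 = b ∧ γ = g '' Set.Icc 0 1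

/-- `γ` is a segment (with some endpoints). -/
def IsSegmentSet (γ : Set ↥Disk) : Prop := ∃ a b, IsSegment γ a b

/-- A translation arc for `f` at `z`. -/
def IsTranslationArc (f : ↥Disk ≃ₜ ↥Disk) (z : ↥Disk) (γ : Set ↥Disk) : Prop :=
  f z ≠ z ∧ IsSegment γ z (f z) ∧
  (f (f z) = z → (⇑f '' γ) ∩ γ = {z, f z}) ∧
  (f (f z) ≠ z → (⇑f '' γ) ∩ γ = {f z})

/-- A closed disk: a subset of `Disk` homeomorphic to the closed unit disk. -/
def IsClosedDisk (D : Set ↥Disk) : Prop := Nonempty (↥D ≃ₜ ↥(Metric.closedBall (0:ℂ) 1))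

/-- A `ℤ`-indexed family of subsets of the disk converges to `{p}` as `k → +∞`. -/
def TendstoSetsTop (A : ℤ → Set ↥Disk) (p : ℂ) : Prop :=
  ∀ ε > (0 : ℝ), ∃ N : ℤ, ∀ k ≥ N, ∀ x ∈ A k, dist x.1 p < ε

/-- A `ℤ`-indexed family of subsets of the disk converges to `{p}` as `k → -∞`. -/
def TendstoSetsBot (A : ℤ → Set ↥Disk) (p : ℂ) : Prop :=
  ∀ ε > (0 : ℝ), ∃ N : ℤ, ∀ k ≤ N, ∀ x ∈ A k, dist x.1 p < ε

/-- `f` extends to a homeomorphism of `Disk ∪ {α, ω}` (as a subspace of `ℂ`). -/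
def ExtendsToBoundary (f : ↥Disk ≃ₜ ↥Disk) (α ω : ℂ) : Prop :=
  ∃ g : ↥(Disk ∪ {α, ω}) ≃ₜ ↥(Disk ∪ {α, ω}),
    ∀ z : ↥Disk, (g ⟨z.1, Set.mem_union_left _ z.2⟩).1 = (f z).1


/-- A function on the circle has a continuous logarithm. -/
def HasLog (F : ↥(Metric.sphere (0:ℂ) 1) → ℂ) : Prop :=
  ∃ l : ↥(Metric.sphere (0:ℂ) 1) → ℂ, Continuous l ∧ ∀ s, Complex.exp (l s) = F s

theorem hasLog_homotopy (F : ↥unitInterval × ↥(Metric.sphere (0:ℂ) 1) → ℂ)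
    (hF : Continuous F) (hne : ∀ p, F p ≠ 0) (h0 : HasLog (fun s => F (0, s))) :
    HasLog (fun s => F (1, s)) := by
  obtain ⟨l, hl, hl'⟩ := h0
  let H : C(↥unitInterval × ↥(Metric.sphere (0:ℂ) 1), {z : ℂ // z ≠ 0}) :=
    ⟨fun p => ⟨F p, hne p⟩, hF.subtype_mk _⟩
  have H0 : ∀ a, H (0, a) = (fun z : ℂ => (⟨_, z.exp_ne_zero⟩ : {z : ℂ // z ≠ 0})) ((⟨l, hl⟩ : C(_, ℂ)) a) := by
    intro a
    apply Subtype.ext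
    exact (hl' a).symm
  refine ⟨fun s => Complex.isCoveringMap_exp.liftHomotopy H ⟨l, hl⟩ H0 (1, s), by fun_prop, fun s => ?_⟩
  have := congrFun (Complex.isCoveringMap_exp.liftHomotopy_lifts H ⟨l, hl⟩ H0) (1, s)
  exact congrArg Subtype.val this

theorem not_hasLog_odd (F : ↥(Metric.sphere (0:ℂ) 1) → ℂ) (hodd : ∀ s, F (-s) = - F s) :
    ¬ HasLog F := by
  rintro ⟨l, hl, hl'⟩
  have hS : IsPreconnected (Set.univ : Set ↥(Metric.sphere (0:ℂ) 1)) := by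
    rw [← Topology.IsInducing.subtypeVal.isPreconnected_image]
    simp only [image_univ, Subtype.range_coe_subtype]
    exact isPreconnected_sphere (by simp) 0 1
  have key : ∀ s, ∃ n : ℤ, l (-s) - l s = (2 * n + 1) * (Real.pi * Complex.I) := by
    intro s
    have h1 : Complex.exp (l (-s)) = Complex.exp (l s + Real.pi * Complex.I) := by
      rw [Complex.exp_add, Complex.exp_pi_mul_I, hl', hl', hodd]; ring
    obtain ⟨n, hn⟩ := Complex.exp_eq_exp_iff_exists_int.1 h1
    exact ⟨n, by rw [hn]; ring⟩
  choose n hn using key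
  have him : ∀ s, (l (-s) - l s).im = (2 * (n s : ℝ) + 1) * Real.pi := by
    intro s; rw [hn]; simp
  have hc : Continuous fun s => (l (-s) - l s).im := by fun_prop
  have hcn : Continuous fun s => (n s : ℝ) := by
    have : (fun s => (n s : ℝ)) = fun s => ((l (-s) - l s).im / Real.pi - 1) / 2 := by
      ext s; rw [him]; field_simp; ring
    rw [this]; fun_prop
  have hcn' : Continuous n := by
    exact Int.isClosedEmbedding_coe_real.isInducing.continuous_iff.2 hcn
  let s0 : ↥(Metric.sphere (0:ℂ) 1) := ⟨1, by simp⟩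
  have hconst : n s0 = n (-s0) := hS.constant hcn'.continuousOn (mem_univ _) (mem_univ _)
  have e1 := him s0
  have e2 := him (-s0)
  rw [neg_neg, ← hconst] at e2
  have e3 : (2 * (n s0 : ℝ) + 1) * Real.pi = 0 := by
    simp only [Complex.sub_im] at e1 e2; linarith
  have e4 : (2 * (n s0 : ℝ) + 1) = 0 := by
    rcases mul_eq_zero.1 e3 with h | h
    · exact h
    · exact absurd h Real.pi_ne_zero
  have e5 : 2 * n s0 + 1 = 0 := by exact_mod_cast e4
  omega

theorem center_mem_interior (g : ℂ → ℂ) (hg : ContinuousOn g (closedBall 0 1))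
    (hinj : InjOn g (closedBall 0 1)) : g 0 ∈ interior (g '' closedBall 0 1) := by
  by_contra hint
  have hJ : IsCompact (g '' sphere 0 1) :=
    (isCompact_sphere 0 1).image_of_continuousOn (hg.mono sphere_subset_closedBall)
  have h0J : g 0 ∉ g '' sphere 0 1 := by
    rintro ⟨s, hs, hs'⟩
    have := hinj (sphere_subset_closedBall hs) (by simp) hs'
    subst this; simp at hs
  obtain ⟨ε, hε, hεJ⟩ := Metric.isOpen_iff.1 hJ.isClosed.isOpen_compl (g 0) h0J
  have : ¬ ball (g 0) ε ⊆ g '' closedBall 0 1 := fun h =>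
    hint (mem_interior.2 ⟨_, h, isOpen_ball, mem_ball_self hε⟩)
  obtain ⟨p, hp, hpK⟩ := not_subset.1 this
  have norm_s : ∀ s : ↥(Metric.sphere (0:ℂ) 1), ‖(s:ℂ)‖ = 1 := fun s => by simp
  have L1 : HasLog (fun s => g s - p) := by
    have := hasLog_homotopy (fun q => g ((q.1 : ℝ) * (q.2 : ℂ)) - p) ?_ ?_ ?_
    · simpa using this
    · refine Continuous.sub (hg.comp_continuous (by fun_prop) fun q => ?_) continuous_const
      simp only [mem_closedBall_zero_iff, norm_mul, Complex.norm_real, norm_s, mul_one, Real.norm_eq_abs]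
      rw [abs_of_nonneg q.1.2.1]; exact q.1.2.2
    · intro q hq
      refine hpK ⟨_, ?_, sub_eq_zero.1 hq⟩
      simp only [mem_closedBall_zero_iff, norm_mul, Complex.norm_real, norm_s, mul_one, Real.norm_eq_abs]
      rw [abs_of_nonneg q.1.2.1]; exact q.1.2.2
    · refine ⟨fun _ => Complex.log (g 0 - p), continuous_const, fun s => ?_⟩
      rw [Complex.exp_log]
      · simp
      · intro h; exact hpK ⟨0, by simp, sub_eq_zero.1 h⟩
  have cg : Continuous fun s : ↥(Metric.sphere (0:ℂ) 1) => g s :=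
    hg.comp_continuous continuous_subtype_val fun s => sphere_subset_closedBall s.2
  have L2 : HasLog (fun s => g s - g 0) := by
    have := hasLog_homotopy (fun q => g q.2 - ((1 - (q.1:ℝ) : ℂ) * p + (q.1 : ℝ) * g 0)) ?_ ?_ ?_
    · simpa using this
    · exact (cg.comp continuous_snd).sub (by fun_prop)
    · intro q hq
      have h1 : ((1 - (q.1:ℝ) : ℂ) * p + (q.1 : ℝ) * g 0) ∈ ball (g 0) ε := by
        have := (convex_ball (g 0) ε) hp (mem_ball_self hε) (a := 1 - (q.1:ℝ)) (b := (q.1:ℝ))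
          (by linarith [q.1.2.2]) q.1.2.1 (by ring)
        simpa using this
      exact hεJ h1 ⟨q.2, q.2.2, sub_eq_zero.1 hq⟩
    · simpa using L1
  have L3 : HasLog (fun s => g s - g (-s)) := by
    have hm : ∀ q : ↥unitInterval × ↥(Metric.sphere (0:ℂ) 1),
        (-((q.1 : ℝ) * (q.2 : ℂ))) ∈ closedBall (0:ℂ) 1 := by
      intro q
      simp only [mem_closedBall_zero_iff, norm_neg, norm_mul, Complex.norm_real, norm_s, mul_one, Real.norm_eq_abs]
      rw [abs_of_nonneg q.1.2.1]; exact q.1.2.2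
    have := hasLog_homotopy (fun q => g q.2 - g (-((q.1 : ℝ) * (q.2 : ℂ)))) ?_ ?_ ?_
    · simpa using this
    · exact (cg.comp continuous_snd).sub (hg.comp_continuous (by fun_prop) hm)
    · intro q hq
      have h := hinj (sphere_subset_closedBall q.2.2) (hm q) (sub_eq_zero.1 hq)
      have h2 : ((1 + (q.1:ℝ) : ℝ) : ℂ) * q.2 = 0 := by push_cast; linear_combination h
      have h3 := congrArg norm h2
      rw [norm_mul, norm_s, Complex.norm_real, Real.norm_eq_abs, mul_one, norm_zero, abs_eq_zero] at h3
      linarith [q.1.2.1]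
    · simpa using L2
  exact not_hasLog_odd _ (fun s => by simp) L3

theorem isOpen_image_plane (g : ℂ → ℂ) (U : Set ℂ) (hU : IsOpen U) (hg : ContinuousOn g U)
    (hinj : InjOn g U) : IsOpen (g '' U) := by
  rw [isOpen_iff_mem_nhds]
  rintro _ ⟨a, ha, rfl⟩
  obtain ⟨r, hr, hrU⟩ := Metric.nhds_basis_closedBall.mem_iff.1 (hU.mem_nhds ha)
  have hm : MapsTo (fun w : ℂ => a + r * w) (closedBall 0 1) (closedBall a r) := by
    intro w hw
    simp only [mem_closedBall_zero_iff] at hw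
    simp only [mem_closedBall, dist_eq_norm, add_sub_cancel_left, norm_mul, Complex.norm_real,
      Real.norm_eq_abs, abs_of_pos hr]
    nlinarith
  have h := center_mem_interior (fun w => g (a + r * w))
    ((hg.mono hrU).comp (by fun_prop) hm) (by
      intro x hx y hy hxy
      have := hinj (hrU (hm hx)) (hrU (hm hy)) hxy
      have hr' : (r:ℂ) ≠ 0 := by exact_mod_cast hr.ne'
      exact mul_left_cancel₀ hr' (add_left_cancel this))
  simp only [mul_zero, add_zero] at h
  refine mem_of_superset (mem_interior_iff_mem_nhds.1 h) ?_
  rintro _ ⟨w, hw, rfl⟩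
  exact ⟨_, hrU (hm hw), rfl⟩

theorem isOpen_image_disk (g : ℂ → ↥Disk) (U : Set ℂ) (hU : IsOpen U) (hg : ContinuousOn g U)
    (hinj : InjOn g U) : IsOpen (g '' U) := by
  have h := isOpen_image_plane (fun w => (g w : ℂ)) U hU
    (continuous_subtype_val.comp_continuousOn hg)
    (fun x hx y hy hxy => hinj hx hy (Subtype.ext hxy))
  have h2 : g '' U = Subtype.val ⁻¹' ((fun w => (g w : ℂ)) '' U) := by
    ext x
    constructor
    · rintro ⟨w, hw, rfl⟩; exact ⟨w, hw, rfl⟩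
    · rintro ⟨w, hw, hx⟩; exact ⟨w, hw, Subtype.ext hx⟩
  rw [h2]
  exact h.preimage continuous_subtype_val

theorem isOpenDisk_image (g : ℂ → ↥Disk) (t : ℝ) (ht : 0 < t)
    (hg : ContinuousOn g (ball 0 t)) (hinj : InjOn g (ball 0 t)) :
    IsOpenDisk (g '' ball 0 t) := by
  refine ⟨isOpen_image_disk g _ isOpen_ball hg hinj, ?_⟩
  have hm : ∀ w : ↥Disk, (t : ℂ) * w ∈ ball (0:ℂ) t := by
    intro w
    have hw : ‖(w:ℂ)‖ < 1 := mem_ball_zero_iff.1 w.2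
    rw [mem_ball_zero_iff, norm_mul, Complex.norm_real, Real.norm_eq_abs, abs_of_pos ht]
    nlinarith
  have ht' : (t : ℂ) ≠ 0 := by exact_mod_cast ht.ne'
  let e0 : ↥Disk → ↥(g '' ball 0 t) := fun w => ⟨g (t * w), _, hm w, rfl⟩
  have hbij : Function.Bijective e0 := by
    constructor
    · intro x y hxy
      have h1 : g (t * x) = g (t * y) := congrArg Subtype.val hxy
      exact Subtype.ext (mul_left_cancel₀ ht' (hinj (hm x) (hm y) h1))
    · rintro ⟨_, w, hw, rfl⟩
      have hw' : ‖w‖ < t := mem_ball_zero_iff.1 hw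
      refine ⟨⟨w / t, ?_⟩, ?_⟩
      · rw [mem_ball_zero_iff, norm_div, Complex.norm_real, Real.norm_eq_abs, abs_of_pos ht, div_lt_one ht]
        exact hw'
      · apply Subtype.ext
        change g (t * (w / t)) = g w
        congr 1; field_simp
  have hcont : Continuous e0 :=
    (hg.comp_continuous (by fun_prop) hm).subtype_mk _
  have hopen : IsOpenMap e0 := by
    intro V hV
    have h1 : IsOpen ((fun w : ↥Disk => g (t * w)) '' V) := by
      have h2 : (fun w : ↥Disk => g (t * w)) '' V
          = (fun w : ℂ => g (t * w)) '' (Subtype.val '' V) := by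
        rw [image_image]
      rw [h2]
      have hsub : MapsTo (fun w : ℂ => (t:ℂ) * w) (Subtype.val '' V) (ball 0 t) := by
        rintro _ ⟨w, _, rfl⟩; exact hm w
      apply isOpen_image_disk
      · exact (isOpen_ball.isOpenMap_subtype_val) _ hV
      · exact hg.comp (by fun_prop) hsub
      · intro x hx y hy hxy
        exact mul_left_cancel₀ ht' (hinj (hsub hx) (hsub hy) hxy)
    have h3 : e0 '' V = Subtype.val ⁻¹' ((fun w : ↥Disk => g (t * w)) '' V) := by
      ext x
      constructor
      · rintro ⟨w, hw, rfl⟩; exact ⟨w, hw, rfl⟩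
      · rintro ⟨w, hw, hx⟩; exact ⟨w, hw, Subtype.ext hx⟩
    rw [h3]
    exact h1.preimage continuous_subtype_val
  exact ⟨((Equiv.ofBijective e0 hbij).toHomeomorphOfContinuousOpen hcont hopen).symm⟩

theorem exists_param (D : Set ↥Disk) (hD : IsClosedDisk D) (z : ↥Disk) (hz : z ∈ interior D) :
    ∃ ψ : ℂ → ↥Disk, ContinuousOn ψ (closedBall 0 1) ∧ InjOn ψ (closedBall 0 1) ∧
      ψ '' closedBall 0 1 = D ∧ ψ 0 = z := by
  obtain ⟨h⟩ := hD
  have hzD := interior_subset hz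
  have ha : ‖(h ⟨z, hzD⟩ : ℂ)‖ < 1 := by
    classical
    let U : Set ℂ := Subtype.val '' interior D
    have hUo : IsOpen U := isOpen_ball.isOpenMap_subtype_val _ isOpen_interior
    have hUD : ∀ w ∈ U, ∃ h1 : w ∈ Disk, (⟨w, h1⟩ : ↥Disk) ∈ D := by
      rintro _ ⟨w, hw, rfl⟩; exact ⟨w.2, interior_subset hw⟩
    let g : ℂ → ℂ := fun w => if hw : ∃ h1 : w ∈ Disk, (⟨w, h1⟩ : ↥Disk) ∈ D
      then (h ⟨⟨w, hw.1⟩, hw.2⟩ : ℂ) else 0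
    have hgU : ∀ w (hw : w ∈ U), g w = (h ⟨⟨w, (hUD w hw).1⟩, (hUD w hw).2⟩ : ℂ) := by
      intro w hw
      exact dif_pos (hUD w hw)
    have hgc : ContinuousOn g U := by
      rw [continuousOn_iff_continuous_domRestrict]
      have : U.domRestrict g = fun w : ↥U => (h ⟨⟨w.1, (hUD w.1 w.2).1⟩, (hUD w.1 w.2).2⟩ : ℂ) := by
        ext w; exact hgU w.1 w.2
      rw [this]
      fun_prop
    have hgi : InjOn g U := by
      intro x hx y hy hxy
      rw [hgU x hx, hgU y hy] at hxy
      have := h.injective (Subtype.ext hxy)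
      exact congrArg (fun q : ↥D => (q.1.1 : ℂ)) this
    have hop := isOpen_image_plane g U hUo hgc hgi
    have hzU : (z : ℂ) ∈ U := ⟨z, hz, rfl⟩
    have hsub : g '' U ⊆ closedBall 0 1 := by
      rintro _ ⟨w, hw, rfl⟩
      rw [hgU w hw]; exact Subtype.coe_prop _
    have := interior_maximal hsub hop ⟨z, hzU, rfl⟩
    rw [interior_closedBall _ one_ne_zero, hgU _ hzU] at this
    exact mem_ball_zero_iff.1 this
  set a : ℂ := (h ⟨z, hzD⟩ : ℂ) with hadef
  let W : ℂ → ℂ := fun w => w + ((1 - ‖w‖ : ℝ) : ℂ) * a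
  have hWc : Continuous W := by fun_prop
  have hWm : MapsTo W (closedBall 0 1) (closedBall 0 1) := by
    intro w hw
    rw [mem_closedBall_zero_iff] at hw ⊢
    calc ‖W w‖ ≤ ‖w‖ + ‖((1 - ‖w‖ : ℝ) : ℂ) * a‖ := norm_add_le _ _
      _ = ‖w‖ + (1 - ‖w‖) * ‖a‖ := by
        rw [norm_mul, Complex.norm_real, Real.norm_eq_abs, abs_of_nonneg (by linarith)]
      _ ≤ 1 := by nlinarith
  have hWi : Function.Injective W := by
    intro x y hxy
    by_contra hne
    have hpos : 0 < ‖x - y‖ := norm_pos_iff.2 (sub_ne_zero.2 hne)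
    have e : x - y = ((‖x‖ - ‖y‖ : ℝ) : ℂ) * a := by
      simp only [W] at hxy; push_cast at hxy ⊢; linear_combination hxy
    have e2 := congrArg norm e
    rw [norm_mul, Complex.norm_real, Real.norm_eq_abs] at e2
    have := abs_norm_sub_norm_le x y
    nlinarith [norm_nonneg a, abs_nonneg (‖x‖ - ‖y‖)]
  have hWs : SurjOn W (closedBall 0 1) (closedBall 0 1) := by
    intro v hv
    rw [mem_closedBall_zero_iff] at hv
    have hc : ContinuousOn (fun r : ℝ => ‖v - ((1 - r : ℝ) : ℂ) * a‖ - r) (Icc 0 1) := by fun_prop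
    obtain ⟨r, hr, hr'⟩ := intermediate_value_Icc' (zero_le_one) hc
      (show (0:ℝ) ∈ Icc _ _ by constructor <;> simp [hv])
    have hr2 : ‖v - ((1 - r : ℝ) : ℂ) * a‖ = r := sub_eq_zero.1 hr'
    refine ⟨v - ((1 - r : ℝ) : ℂ) * a, ?_, ?_⟩
    · rw [mem_closedBall_zero_iff, hr2]; exact hr.2
    · simp only [W]; rw [hr2]; ring
  classical
  let ψ : ℂ → ↥Disk := fun w =>
    if hw : w ∈ closedBall (0:ℂ) 1 then (h.symm ⟨W w, hWm hw⟩ : ↥Disk) else z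
  have hψ : ∀ w (hw : w ∈ closedBall (0:ℂ) 1), ψ w = (h.symm ⟨W w, hWm hw⟩ : ↥Disk) :=
    fun w hw => dif_pos hw
  refine ⟨ψ, ?_, ?_, ?_, ?_⟩
  · rw [continuousOn_iff_continuous_domRestrict]
    have : (closedBall (0:ℂ) 1).domRestrict ψ
        = fun w : ↥(closedBall (0:ℂ) 1) => (h.symm ⟨W w.1, hWm w.2⟩ : ↥Disk) := by
      ext w; exact congrArg Subtype.val (hψ w.1 w.2)
    rw [this]
    fun_prop
  · intro x hx y hy hxy
    rw [hψ x hx, hψ y hy] at hxy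
    have := h.symm.injective (Subtype.ext hxy)
    exact hWi (congrArg Subtype.val this)
  · ext x
    constructor
    · rintro ⟨w, hw, rfl⟩
      rw [hψ w hw]; exact Subtype.coe_prop _
    · intro hx
      obtain ⟨w, hw, hw'⟩ := hWs (h ⟨x, hx⟩).2
      refine ⟨w, hw, ?_⟩
      rw [hψ w hw]
      have : (⟨W w, hWm hw⟩ : ↥(closedBall (0:ℂ) 1)) = h ⟨x, hx⟩ := Subtype.ext hw'
      rw [this, h.symm_apply_apply]
  · rw [hψ 0 (by simp)]
    have : (⟨W 0, hWm (by simp)⟩ : ↥(closedBall (0:ℂ) 1)) = h ⟨z, hzD⟩ :=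
      Subtype.ext (by simp [W, hadef])
    rw [this, h.symm_apply_apply]

theorem fiter_succ (f : ↥Disk ≃ₜ ↥Disk) (k : ℤ) (z : ↥Disk) :
    fiter f (k + 1) z = f (fiter f k z) := by
  unfold fiter
  rw [add_comm, zpow_one_add]; rfl

theorem fiter_zero (f : ↥Disk ≃ₜ ↥Disk) (z : ↥Disk) : fiter f 0 z = z := by
  unfold fiter; simp

theorem norm_eq_of_touch (F : ↥Disk ≃ₜ ↥Disk) (ψ : ℂ → ↥Disk) (t : ℝ) (ht : 0 < t)
    (hc : ContinuousOn ψ (closedBall 0 t)) (hU : IsOpen (ψ '' ball 0 t))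
    (hfree : ∀ p ∈ ball (0:ℂ) t, ∀ q ∈ ball (0:ℂ) t, F (ψ p) ≠ ψ q)
    (p q : ℂ) (hp : ‖p‖ ≤ t) (hq : ‖q‖ ≤ t) (h : F (ψ p) = ψ q) : ‖p‖ = t ∧ ‖q‖ = t := by
  have hcl : ∀ x : ℂ, ‖x‖ ≤ t → x ∈ closure (ball (0:ℂ) t) := by
    intro x hx
    rw [closure_ball _ ht.ne']; simpa using hx
  constructor
  · by_contra hne
    have hlt : p ∈ ball (0:ℂ) t := mem_ball_zero_iff.2 (lt_of_le_of_ne hp hne)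
    have hV : IsOpen (F '' (ψ '' ball 0 t)) := F.isOpenMap _ hU
    have hmem : F '' (ψ '' ball 0 t) ∈ 𝓝 (ψ q) := hV.mem_nhds ⟨_, ⟨p, hlt, rfl⟩, h⟩
    have h1 := (hc q (by simpa using hq)).mono ball_subset_closedBall hmem
    have : (𝓝[ball (0:ℂ) t] q).NeBot := mem_closure_iff_nhdsWithin_neBot.1 (hcl q hq)
    obtain ⟨q', hq', hq2⟩ := (Filter.inter_mem h1 self_mem_nhdsWithin : _ ∈ 𝓝[ball (0:ℂ) t] q) |>
      Filter.nonempty_of_mem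
    obtain ⟨_, ⟨p', hp', rfl⟩, hpq⟩ := hq'
    exact hfree p' hp' q' hq2 hpq
  · by_contra hne
    have hlt : q ∈ ball (0:ℂ) t := mem_ball_zero_iff.2 (lt_of_le_of_ne hq hne)
    have hmem : ψ '' ball 0 t ∈ 𝓝 (F (ψ p)) := hU.mem_nhds ⟨q, hlt, h.symm⟩
    have hFc : ContinuousOn (fun x => F (ψ x)) (closedBall 0 t) := F.continuous.comp_continuousOn hc
    have h1 := (hFc p (by simpa using hp)).mono ball_subset_closedBall hmem
    have : (𝓝[ball (0:ℂ) t] p).NeBot := mem_closure_iff_nhdsWithin_neBot.1 (hcl p hp)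
    obtain ⟨p', hp', hp2⟩ := (Filter.inter_mem h1 self_mem_nhdsWithin : _ ∈ 𝓝[ball (0:ℂ) t] p) |>
      Filter.nonempty_of_mem
    obtain ⟨q', hq', hpq⟩ := hp'
    exact hfree p' hp2 q' hq' hpq.symm

theorem exists_translation_arc (f : ↥Disk ≃ₜ ↥Disk) (hrec : ¬ RecurrentHomeo f)
    (ψ : ℂ → ↥Disk) (hc : ContinuousOn ψ (closedBall 0 1)) (hinj : InjOn ψ (closedBall 0 1))
    (hfix : ∀ w ∈ closedBall (0:ℂ) 1, f (ψ w) ≠ ψ w)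
    (hmeet : ∃ p ∈ closedBall (0:ℂ) 1, ∃ q ∈ closedBall (0:ℂ) 1, f (ψ p) = ψ q) :
    ∃ γ : Set ↥Disk, IsTranslationArc f (ψ 0) γ ∧
      γ ⊆ ψ '' closedBall 0 1 ∪ f '' (ψ '' closedBall 0 1) := by
  let B : Set (ℂ × ℂ) := closedBall (0:ℂ) 1 ×ˢ closedBall (0:ℂ) 1
  let K : Set (ℂ × ℂ) := B ∩ (fun x : ℂ × ℂ => (f (ψ x.1), ψ x.2)) ⁻¹' diagonal ↥Disk
  have hBc : IsCompact B := (isCompact_closedBall 0 1).prod (isCompact_closedBall 0 1)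
  have hKc : IsCompact K := by
    refine hBc.of_isClosed_subset ?_ inter_subset_left
    refine ContinuousOn.preimage_isClosed_of_isClosed ?_ hBc.isClosed isClosed_diagonal
    refine ContinuousOn.prodMk (f.continuous.comp_continuousOn ?_) ?_
    · exact hc.comp continuousOn_fst fun x hx => hx.1
    · exact hc.comp continuousOn_snd fun x hx => hx.2
  have hKn : K.Nonempty := by
    obtain ⟨p, hp, q, hq, h⟩ := hmeet
    exact ⟨(p, q), ⟨hp, hq⟩, h⟩
  obtain ⟨⟨u, v⟩, ⟨⟨huB, hvB⟩, huv⟩, hmin⟩ := hKc.exists_isMinOn hKn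
    (f := fun x : ℂ × ℂ => max ‖x.1‖ ‖x.2‖) (by fun_prop)
  replace huv : f (ψ u) = ψ v := huv
  simp only at huB hvB
  set t : ℝ := max ‖u‖ ‖v‖ with htdef
  have hmin' : ∀ p q : ℂ, ‖p‖ ≤ 1 → ‖q‖ ≤ 1 → f (ψ p) = ψ q → t ≤ max ‖p‖ ‖q‖ := by
    intro p q hp hq hpq
    have : (p, q) ∈ K := ⟨⟨by simpa using hp, by simpa using hq⟩, hpq⟩
    exact hmin this
  have ht1 : t ≤ 1 := max_le (by simpa using huB) (by simpa using hvB)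
  have hut : ‖u‖ ≤ t := le_max_left _ _
  have hvt : ‖v‖ ≤ t := le_max_right _ _
  have ht : 0 < t := by
    by_contra hle
    have h1 : u = 0 := norm_le_zero_iff.1 (by linarith)
    have h2 : v = 0 := norm_le_zero_iff.1 (by linarith)
    rw [h1, h2] at huv
    exact hfix 0 (by simp) huv
  have hct : ContinuousOn ψ (closedBall 0 t) := hc.mono (closedBall_subset_closedBall ht1)
  have hit : InjOn ψ (closedBall 0 t) := hinj.mono (closedBall_subset_closedBall ht1)
  have hdisk : IsOpenDisk (ψ '' ball 0 t) := isOpenDisk_image ψ t ht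
    (hct.mono ball_subset_closedBall) (hit.mono ball_subset_closedBall)
  have hfree : ∀ p ∈ ball (0:ℂ) t, ∀ q ∈ ball (0:ℂ) t, f (ψ p) ≠ ψ q := by
    intro p hp q hq hpq
    rw [mem_ball_zero_iff] at hp hq
    have := hmin' p q (by linarith) (by linarith) hpq
    exact absurd this (not_le.2 (max_lt hp hq))
  have hfree2 : ∀ p ∈ ball (0:ℂ) t, ∀ q ∈ ball (0:ℂ) t, (f.trans f) (ψ p) ≠ ψ q := by
    intro p hp q hq hpq
    apply hrec
    refine ⟨1, le_rfl, fun _ => ψ '' ball 0 t, fun _ => hdisk, fun _ => ?_, ?_, fun _ => ?_⟩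
    · unfold IsFreeSet
      rw [eq_empty_iff_forall_notMem]
      rintro x ⟨⟨_, ⟨p', hp', rfl⟩, h1⟩, ⟨q', hq', h2⟩⟩
      exact hfree p' hp' q' hq' (h1.trans h2.symm)
    · intro i j hij
      exact absurd (Subsingleton.elim (α := Fin 1) i j) hij
    · refine ⟨2, by norm_num, ψ q, ⟨ψ p, ⟨p, hp, rfl⟩, ?_⟩, ⟨q, hq, rfl⟩⟩
      rw [show (2:ℤ) = 0 + 1 + 1 by norm_num, fiter_succ, fiter_succ, fiter_zero]
      exact hpq
  have F1 := norm_eq_of_touch f ψ t ht hct hdisk.1 hfree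
  have F2 : ∀ p q : ℂ, ‖p‖ ≤ t → ‖q‖ ≤ t → f (f (ψ p)) = ψ q → ‖p‖ = t ∧ ‖q‖ = t :=
    norm_eq_of_touch (f.trans f) ψ t ht hct hdisk.1 hfree2
  obtain ⟨hu, hv⟩ := F1 u v hut hvt huv
  have hnorm : ∀ (w : ℂ) (c : ℝ), ‖w‖ = t → 0 ≤ c → ‖(c:ℂ) * w‖ = c * t := by
    intro w c hw hc0
    rw [norm_mul, Complex.norm_real, Real.norm_eq_abs, abs_of_nonneg hc0, hw]
  have hle : ∀ (w : ℂ) (c : ℝ), ‖w‖ = t → 0 ≤ c → c ≤ 1 → ‖(c:ℂ) * w‖ ≤ t := by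
    intro w c hw hc0 hc1
    rw [hnorm w c hw hc0]; nlinarith
  have hone : ∀ (w : ℂ) (c : ℝ), ‖w‖ = t → 0 ≤ c → ‖(c:ℂ) * w‖ = t → c = 1 := by
    intro w c hw hc0 h
    rw [hnorm w c hw hc0] at h
    have : (c - 1) * t = 0 := by linarith
    rcases mul_eq_zero.1 this with h | h <;> linarith
  have hcb : ∀ (w : ℂ) (c : ℝ), ‖w‖ = t → 0 ≤ c → c ≤ 1 → (c:ℂ) * w ∈ closedBall (0:ℂ) t := by
    intro w c hw hc0 hc1
    simpa using hle w c hw hc0 hc1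
  have hu0 : u ≠ 0 := by rintro rfl; simp at hu; linarith
  have hv0 : v ≠ 0 := by rintro rfl; simp at hv; linarith
  have hfixu : f (ψ u) ≠ ψ u := hfix u huB
  have hfixv : f (ψ v) ≠ ψ v := hfix v hvB
  let g : ℝ → ↥Disk := fun s =>
    if s ≤ 1/2 then ψ ((2 * s : ℝ) * v) else f (ψ ((2 - 2 * s : ℝ) * u))
  let γ : Set ↥Disk := g '' Icc 0 1
  have hγ : ∀ x ∈ γ, (∃ c : ℝ, 0 ≤ c ∧ c ≤ 1 ∧ x = ψ (c * v)) ∨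
      (∃ c : ℝ, 0 ≤ c ∧ c ≤ 1 ∧ x = f (ψ (c * u))) := by
    rintro _ ⟨s, ⟨hs0, hs1⟩, rfl⟩
    by_cases h : s ≤ 1/2
    · exact Or.inl ⟨2 * s, by linarith, by linarith, if_pos h⟩
    · exact Or.inr ⟨2 - 2 * s, by linarith, by linarith, if_neg h⟩
  have hgc : ContinuousOn g (Icc 0 1) := by
    refine ContinuousOn.if ?_ ?_ ?_
    · rintro s ⟨_, hs⟩
      have : s = 1/2 := frontier_Iic_subset _ hs
      subst this
      norm_num
      exact huv.symm
    · refine hct.comp (by fun_prop) ?_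
      rintro s ⟨hs, hs2⟩
      rw [closure_le_eq continuous_id' continuous_const] at hs2
      have hs2' : s ≤ 1/2 := hs2
      exact hcb v _ hv (by linarith [hs.1]) (by linarith)
    · refine f.continuous.comp_continuousOn (hct.comp (by fun_prop) ?_)
      rintro s ⟨hs, hs2⟩
      simp only [not_le] at hs2
      have hs2' : 1/2 ≤ s := closure_lt_subset_le continuous_const continuous_id' hs2
      exact hcb u _ hu (by linarith [hs.2]) (by linarith)
  have hcross : ∀ s s' : ℝ, s ∈ Icc (0:ℝ) 1 → s' ∈ Icc (0:ℝ) 1 → s ≤ 1/2 → ¬ s' ≤ 1/2 →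
      g s ≠ g s' := by
    intro s s' hs hs' h1 h2 h
    simp only [g, if_pos h1, if_neg h2] at h
    push Not at h2
    have := (F1 _ _ (hle u _ hu (by linarith [hs'.2]) (by linarith))
      (hle v _ hv (by linarith [hs.1]) (by linarith)) h.symm).1
    have := hone u _ hu (by linarith [hs'.2]) this
    linarith
  have hgi : InjOn g (Icc 0 1) := by
    intro s hs s' hs' h
    by_cases h1 : s ≤ 1/2 <;> by_cases h2 : s' ≤ 1/2
    · simp only [g, if_pos h1, if_pos h2] at h
      have := hit (hcb v _ hv (by linarith [hs.1]) (by linarith))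
        (hcb v _ hv (by linarith [hs'.1]) (by linarith)) h
      have := mul_right_cancel₀ hv0 this
      have := Complex.ofReal_injective this
      linarith
    · exact absurd h (hcross s s' hs hs' h1 h2)
    · exact absurd h.symm (hcross s' s hs' hs h2 h1)
    · simp only [g, if_neg h1, if_neg h2] at h
      push Not at h1 h2
      have := hit (hcb u _ hu (by linarith [hs.2]) (by linarith))
        (hcb u _ hu (by linarith [hs'.2]) (by linarith)) (f.injective h)
      have := mul_right_cancel₀ hu0 this
      have := Complex.ofReal_injective this
      linarith
  have hg0 : g 0 = ψ 0 := by
    simp only [g]; rw [if_pos (by norm_num)]; simp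
  have hg1 : g 1 = f (ψ 0) := by
    simp only [g]; rw [if_neg (by norm_num)]; simp
  refine ⟨γ, ⟨hfix 0 (by simp), ⟨g, hgc, hgi, hg0, hg1, rfl⟩, ?_, ?_⟩, ?_⟩
  · intro h
    have := (F2 0 0 (by simp [ht.le]) (by simp [ht.le]) h).1
    simp at this; linarith
  · intro _
    apply Subset.antisymm
    · rintro _ ⟨⟨x, hx, rfl⟩, hy⟩
      rw [mem_singleton_iff]
      rcases hγ x hx with ⟨c, hc0, hc1, rfl⟩ | ⟨c, hc0, hc1, rfl⟩ <;>
        rcases hγ _ hy with ⟨d, hd0, hd1, h⟩ | ⟨d, hd0, hd1, h⟩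
      · obtain ⟨h1, h2⟩ := F1 _ _ (hle v c hv hc0 hc1) (hle v d hv hd0 hd1) h
        have e1 := hone v c hv hc0 h1
        have e2 := hone v d hv hd0 h2
        subst e1; subst e2
        simp only [Complex.ofReal_one, one_mul] at h
        exact absurd h hfixv
      · have h1 := hit (hcb v c hv hc0 hc1) (hcb u d hu hd0 hd1) (f.injective h)
        have h2 := congrArg norm h1
        rw [hnorm v c hv hc0, hnorm u d hu hd0] at h2
        have h3 : c = d := mul_right_cancel₀ ht.ne' h2
        subst h3
        by_cases hc : c = 0
        · subst hc; simp
        · have h4 : v = u := mul_left_cancel₀ (by exact_mod_cast hc) h1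
          rw [h4] at huv
          exact absurd huv hfixu
      · obtain ⟨h1, h2⟩ := F2 _ _ (hle u c hu hc0 hc1) (hle v d hv hd0 hd1) h
        have e1 := hone u c hu hc0 h1
        have e2 := hone v d hv hd0 h2
        subst e1; subst e2
        simp only [Complex.ofReal_one, one_mul] at h
        rw [← huv] at h
        exact absurd (f.injective h) hfixu
      · obtain ⟨h1, h2⟩ := F1 _ _ (hle u c hu hc0 hc1) (hle u d hu hd0 hd1) (f.injective h)
        have e1 := hone u c hu hc0 h1
        have e2 := hone u d hu hd0 h2
        subst e1; subst e2
        simp only [Complex.ofReal_one, one_mul] at h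
        exact absurd (f.injective h) hfixu
    · rintro _ rfl
      exact ⟨⟨ψ 0, ⟨0, by simp, hg0⟩, rfl⟩, ⟨1, by simp, hg1⟩⟩
  · intro x hx
    have hsub := closedBall_subset_closedBall (x := (0:ℂ)) ht1
    rcases hγ x hx with ⟨c, hc0, hc1, rfl⟩ | ⟨c, hc0, hc1, rfl⟩
    · exact Or.inl ⟨_, hsub (hcb v c hv hc0 hc1), rfl⟩
    · exact Or.inr ⟨_, ⟨_, hsub (hcb u c hu hc0 hc1), rfl⟩, rfl⟩

theorem extension_control (f : ↥Disk ≃ₜ ↥Disk) (z : ↥Disk) (α ω p : ℂ)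
    (hext : ExtendsToBoundary f α ω) (hp : p ∈ ({α, ω} : Set ℂ)) (l : Filter ℤ) [l.NeBot]
    (hl : Tendsto (fun k : ℤ => k + 1) l l)
    (hlim : Tendsto (fun k : ℤ => (fiter f k z).1) l (nhds p)) :
    ∀ ε > (0:ℝ), ∃ δ > (0:ℝ), ∀ x : ↥Disk, dist x.1 p < δ → dist (f x).1 p < ε := by
  obtain ⟨g, hg⟩ := hext
  let P : ↥(Disk ∪ {α, ω}) := ⟨p, Or.inr hp⟩
  have h1 : Tendsto (fun k : ℤ => (⟨(fiter f k z).1, Or.inl (fiter f k z).2⟩ : ↥(Disk ∪ {α, ω})))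
      l (nhds P) := tendsto_subtype_rng.2 hlim
  have h2 := (continuous_subtype_val.comp g.continuous).continuousAt.tendsto.comp h1
  have h3 : Tendsto (fun k : ℤ => (fiter f (k + 1) z).1) l (nhds p) := hlim.comp hl
  have h4 : (g P).1 = p := by
    refine tendsto_nhds_unique h2 (h3.congr fun k => ?_)
    rw [fiter_succ, ← hg]; rfl
  intro ε hε
  obtain ⟨δ, hδ, h5⟩ := Metric.continuousAt_iff.1 (g.continuous.continuousAt (x := P)) ε hε
  refine ⟨δ, hδ, fun x hx => ?_⟩
  have h6 := h5 (x := ⟨x.1, Or.inl x.2⟩) hx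
  rw [Subtype.dist_eq, h4, hg] at h6
  exact h6

/-- Proposition 3.1 (derived from the conclusion of Lemma 3.4). -/
theorem handel_prop_3_1 (f : ↥Disk ≃ₜ ↥Disk) (z : ↥Disk) (α ω : ℂ)
    (hα : α ∈ Metric.sphere (0:ℂ) 1) (hω : ω ∈ Metric.sphere (0:ℂ) 1) (hαω : α ≠ ω)
    (hlimₘ : Tendsto (fun k : ℤ => (fiter f k z).1) atBot (nhds α))
    (hlimₚ : Tendsto (fun k : ℤ => (fiter f k z).1) atTop (nhds ω))
    (hext : ExtendsToBoundary f α ω)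
    (D : ℤ → Set ↥Disk)
    (hdisk : ∀ k, IsClosedDisk (D k))
    (hdisj : Pairwise fun k k' => Disjoint (D k) (D k'))
    (hmem : ∀ k, fiter f k z ∈ interior (D k))
    (hfix : ∀ k, ∀ x ∈ D k, f x ≠ x)
    (hmeet : ∀ k, ((⇑f '' D k) ∩ D k).Nonempty)
    (hpast : ∀ k k' : ℤ, k' < k →
      (⇑f '' D k) ∩ D k' = ∅ ∧ (⇑f '' (⇑f '' D k)) ∩ D k' = ∅)
    (hconvₘ : TendstoSetsBot D α) (hconvₚ : TendstoSetsTop D ω) :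
    RecurrentHomeo f ∨
      ∃ γ : ℤ → Set ↥Disk,
        (∀ k, IsTranslationArc f (fiter f k z) (γ k)) ∧
        (∀ k k' : ℤ, k' < k → (⇑f '' γ k) ∩ γ k' = ∅) ∧
        TendstoSetsBot γ α ∧ TendstoSetsTop γ ω := by
  by_cases hrec : RecurrentHomeo f
  · exact Or.inl hrec
  right
  have main : ∀ k : ℤ, ∃ γ : Set ↥Disk, IsTranslationArc f (fiter f k z) γ ∧
      γ ⊆ D k ∪ f '' D k := by
    intro k
    obtain ⟨ψ, hc, hi, hD, h0⟩ := exists_param (D k) (hdisk k) _ (hmem k)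
    have := exists_translation_arc f hrec ψ hc hi
      (fun w hw => hfix k _ (hD ▸ mem_image_of_mem ψ hw)) (by
        obtain ⟨x, ⟨y, hy, rfl⟩, hx⟩ := hmeet k
        rw [← hD] at hy hx
        obtain ⟨p, hp, rfl⟩ := hy
        obtain ⟨q, hq, hq'⟩ := hx
        exact ⟨p, hp, q, hq, hq'.symm⟩)
    rwa [h0, hD] at this
  choose γ hγ hsub using main
  refine ⟨γ, hγ, ?_, ?_, ?_⟩
  · intro k k' hk
    obtain ⟨p1, p2⟩ := hpast k k' hk
    have hd := disjoint_left.1 (hdisj hk.ne')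
    rw [eq_empty_iff_forall_notMem] at p1 p2 ⊢
    rintro _ ⟨⟨x, hx, rfl⟩, hy⟩
    rcases hsub k hx with hx' | ⟨x, hx', rfl⟩ <;> rcases hsub k' hy with hy | ⟨y, hy, h⟩
    · exact p1 _ ⟨⟨x, hx', rfl⟩, hy⟩
    · exact hd hx' (f.injective h ▸ hy)
    · exact p2 _ ⟨⟨_, ⟨x, hx', rfl⟩, rfl⟩, hy⟩
    · exact p1 _ ⟨⟨x, hx', rfl⟩, f.injective h ▸ hy⟩
  · intro ε hε
    obtain ⟨δ, hδ, h⟩ := extension_control f z α ω α hext (by simp) atBot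
      (tendsto_atBot_add_const_right _ _ tendsto_id) hlimₘ ε hε
    obtain ⟨N, hN⟩ := hconvₘ (min δ ε) (lt_min hδ hε)
    refine ⟨N, fun k hk x hx => ?_⟩
    rcases hsub k hx with hx | ⟨y, hy, rfl⟩
    · exact (hN k hk x hx).trans_le (min_le_right _ _)
    · exact h y ((hN k hk y hy).trans_le (min_le_left _ _))
  · intro ε hε
    obtain ⟨δ, hδ, h⟩ := extension_control f z α ω ω hext (by simp) atTop
      (tendsto_atTop_add_const_right _ _ tendsto_id) hlimₚ ε hε
    obtain ⟨N, hN⟩ := hconvₚ (min δ ε) (lt_min hδ hε)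
    refine ⟨N, fun k hk x hx => ?_⟩
    rcases hsub k hx with hx | ⟨y, hy, rfl⟩
    · exact (hN k hk x hx).trans_le (min_le_right _ _)
    · exact h y ((hN k hk y hy).trans_le (min_le_left _ _))
end
end

section
/- Let f be a homeomorphism of the open unit disk 𝔻, let z ∈ 𝔻 and let α, ω be two distinct points of S¹. Suppose given a sequence (γ'^k)_{k∈ℤ} of pairwise disjoint segments in 𝔻 such that for every k ∈ ℤ: f^k(z) ∈ γ'^k; γ'^k ∩ Fix(f) = ∅; f(γ'^k) ∩ γ'^k ≠ ∅; and (γ'^k) converges to {α} as k → −∞ and to {ω} as k → +∞. Then there exists a sequence (D'^k)_{k∈ℤ} of pairwise disjoint closed disks in 𝔻 such that for every k ∈ ℤ: f^k(z) ∈ ∂D'^k; D'^k ∩ Fix(f) = ∅; f(D'^k) ∩ D'^k ≠ ∅; f(Int(D'^k)) ∩ Int(D'^k) = ∅; and (D'^k) converges to {α} as k → −∞ and to {ω} as k → +∞. (Lemma 3.3, derived from the conclusion of Lemma 3.2.) -/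
open Set Filter Metric Topology

noncomputable section

/-- A homeomorphism of the plane supported in `ball q r`, moving a nearby point to the center. -/
theorem exists_push_s5 (q y' : ℂ) (r : ℝ) (h : dist y' q < r / 2) :
    ∃ Φ : ℂ ≃ₜ ℂ, Φ y' = q ∧ (∀ w, w ∉ ball q r → Φ w = w) ∧ (∀ w ∈ ball q r, Φ w ∈ ball q r) := by
  have hr : 0 < r / 2 := lt_of_le_of_lt dist_nonneg h
  set ρ := r / 2 with hρ
  have hrr : r = 2 * ρ := by rw [hρ]; ring
  set g : ℂ → ℂ := fun w => w + ((max 0 (1 - dist w y' / ρ) : ℝ) : ℂ) * (q - y') with hg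
  have hnorm : ‖q - y'‖ < ρ := by rw [← dist_eq_norm, dist_comm]; exact h
  have hlip : ∀ a b : ℂ, |max 0 (1 - dist a y' / ρ) - max 0 (1 - dist b y' / ρ)| ≤ dist a b / ρ := by
    intro a b
    have h1 := abs_max_sub_max_le_abs (1 - dist a y' / ρ) (1 - dist b y' / ρ) 0
    rw [max_comm 0, max_comm 0]
    refine h1.trans ?_
    have : 1 - dist a y' / ρ - (1 - dist b y' / ρ) = (dist b y' - dist a y') / ρ := by ring
    rw [this, abs_div, abs_of_pos hr]
    gcongr
    rw [dist_comm a b]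
    exact abs_dist_sub_le b a y'
  have happ : ApproximatesLinearOn g ((ContinuousLinearEquiv.refl ℝ ℂ : ℂ ≃L[ℝ] ℂ) : ℂ →L[ℝ] ℂ)
      univ (Real.toNNReal (‖q - y'‖ / ρ)) := by
    intro a _ b _
    have : g a - g b - ((ContinuousLinearEquiv.refl ℝ ℂ : ℂ ≃L[ℝ] ℂ) : ℂ →L[ℝ] ℂ) (a - b)
        = ((max 0 (1 - dist a y' / ρ) - max 0 (1 - dist b y' / ρ) : ℝ) : ℂ) * (q - y') := by
      simp only [hg, ContinuousLinearEquiv.coe_coe, ContinuousLinearEquiv.refl_apply,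
        Complex.ofReal_sub]
      ring
    rw [this, norm_mul, Complex.norm_real, Real.norm_eq_abs, Real.coe_toNNReal _ (by positivity)]
    calc _ ≤ dist a b / ρ * ‖q - y'‖ := by gcongr; exact hlip a b
      _ = ‖q - y'‖ / ρ * ‖a - b‖ := by rw [dist_eq_norm]; ring
  have hc : (Real.toNNReal (‖q - y'‖ / ρ)) <
      ‖(((ContinuousLinearEquiv.refl ℝ ℂ : ℂ ≃L[ℝ] ℂ)).symm : ℂ →L[ℝ] ℂ)‖₊⁻¹ := by
    have : ‖(((ContinuousLinearEquiv.refl ℝ ℂ : ℂ ≃L[ℝ] ℂ)).symm : ℂ →L[ℝ] ℂ)‖₊ = 1 := by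
      apply NNReal.eq
      exact ContinuousLinearMap.norm_id
    rw [this, inv_one, ← NNReal.coe_lt_coe]
    rw [Real.coe_toNNReal _ (by positivity), NNReal.coe_one]
    rw [div_lt_one hr]; exact hnorm
  have hgoal : ∀ w, (happ.toHomeomorph g (Or.inr hc)) w = g w := fun w => rfl
  have hfar : ∀ w, ρ ≤ dist w y' → g w = w := by
    intro w hw
    have : max 0 (1 - dist w y' / ρ) = 0 := by
      apply max_eq_left
      have := (one_le_div hr).2 hw
      linarith
    simp [hg, this]
  refine ⟨happ.toHomeomorph g (Or.inr hc), ?_, ?_, ?_⟩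
  · rw [hgoal]; simp [hg]
  · intro w hw
    rw [hgoal]
    apply hfar
    rw [mem_ball, not_lt] at hw
    have := dist_triangle w y' q
    linarith
  · intro w hw
    rw [hgoal]
    by_cases hwy : ρ ≤ dist w y'
    · rw [hfar w hwy]; exact hw
    · rw [not_le] at hwy
      have hmax : max 0 (1 - dist w y' / ρ) = 1 - dist w y' / ρ := by
        apply max_eq_right
        have := (div_lt_one hr).2 hwy
        linarith
      have : g w - q = (w - y') - ((dist w y' / ρ : ℝ) : ℂ) * (q - y') := by
        simp only [hg, hmax, Complex.ofReal_sub, Complex.ofReal_one]; ring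
      rw [mem_ball, dist_eq_norm, this]
      have h2 : ‖((dist w y' / ρ : ℝ) : ℂ) * (q - y')‖ ≤ ‖q - y'‖ := by
        rw [norm_mul, Complex.norm_real, Real.norm_eq_abs, abs_of_nonneg (by positivity)]
        have := (div_lt_one hr).2 hwy
        nlinarith [norm_nonneg (q - y')]
      have h3 := norm_sub_le (w - y') (((dist w y' / ρ : ℝ) : ℂ) * (q - y'))
      rw [dist_eq_norm] at hwy
      linarith

/-- Enlarging an embedded open disk in `U` to contain one more point. -/
theorem extend_emb (U : Set ℂ) (hU : IsOpen U) (hc : IsPreconnected U) (F : Set ℂ) (hF : IsClosed F)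
    (H₀ : ℂ → ℂ) (hH₀ : IsOpenEmbedding H₀) (hr₀ : range H₀ ⊆ U) (hF₀ : F ⊆ range H₀)
    (y : ℂ) (hy : y ∈ U) :
    ∃ H : ℂ → ℂ, IsOpenEmbedding H ∧ range H ⊆ U ∧ F ⊆ range H ∧ y ∈ range H := by
  let S : Set ℂ := {y | ∃ H : ℂ → ℂ, IsOpenEmbedding H ∧ range H ⊆ U ∧ F ⊆ range H ∧ y ∈ range H}
  have hS : U ⊆ S := by
    apply hc.subset_of_closure_inter_subset
    · rw [isOpen_iff_mem_nhds]
      rintro a ⟨H, h1, h2, h3, h4⟩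
      filter_upwards [h1.isOpen_range.mem_nhds h4] with b hb
      exact ⟨H, h1, h2, h3, hb⟩
    · exact ⟨H₀ 0, hr₀ (mem_range_self _), H₀, hH₀, hr₀, hF₀, mem_range_self _⟩
    · rintro q ⟨hq, hqU⟩
      by_cases hqF : q ∈ F
      · exact ⟨H₀, hH₀, hr₀, hF₀, hF₀ hqF⟩
      · obtain ⟨r, hr, hb⟩ := Metric.isOpen_iff.1 (hU.inter hF.isOpen_compl) q ⟨hqU, hqF⟩
        obtain ⟨y', ⟨H, h1, h2, h3, ⟨t, rfl⟩⟩, hd⟩ := Metric.mem_closure_iff.1 hq (r / 2) (by positivity)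
        rw [dist_comm] at hd
        obtain ⟨Φ, e1, e2, e3⟩ := exists_push_s5 q (H t) r hd
        refine ⟨Φ ∘ H, Φ.isOpenEmbedding.comp h1, ?_, ?_, ⟨t, e1⟩⟩
        · rintro _ ⟨s, rfl⟩
          by_cases hs : H s ∈ ball q r
          · exact (hb (e3 _ hs)).1
          · simp only [Function.comp, e2 _ hs]; exact h2 (mem_range_self _)
        · intro w hw
          obtain ⟨s, rfl⟩ := h3 hw
          refine ⟨s, e2 _ fun hs => (hb hs).2 hw⟩
  exact hS hy

theorem exists_emb (U : Set ℂ) (hU : IsOpen U) (hc : IsPreconnected U) (p x y : ℂ)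
    (hp : p ∈ U) (hx : x ∈ U) (hy : y ∈ U) :
    ∃ H : ℂ → ℂ, IsOpenEmbedding H ∧ range H ⊆ U ∧ p ∈ range H ∧ x ∈ range H ∧ y ∈ range H := by
  obtain ⟨r, hr, hb⟩ := Metric.isOpen_iff.1 hU p hp
  let e := OpenPartialHomeomorph.univBall p r
  have he : IsOpenEmbedding e := e.isOpenEmbedding (OpenPartialHomeomorph.univBall_source p r)
  have hre : range e ⊆ U := by
    rintro _ ⟨s, rfl⟩
    apply hb
    rw [← OpenPartialHomeomorph.univBall_target p hr]
    apply e.map_source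
    rw [OpenPartialHomeomorph.univBall_source]; trivial
  obtain ⟨H1, a1, a2, a3, a4⟩ := extend_emb U hU hc ∅ isClosed_empty e he hre (empty_subset _) p hp
  obtain ⟨H2, b1, b2, b3, b4⟩ := extend_emb U hU hc {p} isClosed_singleton H1 a1 a2
    (singleton_subset_iff.2 a4) x hx
  obtain ⟨H3, c1, c2, c3, c4⟩ := extend_emb U hU hc {p, x} (Set.toFinite _).isClosed H2 b1 b2
    (by rintro w (rfl | rfl); exacts [b3 rfl, b4]) y hy
  exact ⟨H3, c1, c2, c3 (by simp), c3 (by simp), c4⟩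

/-- The parabolic shear. -/
def shear (C : ℝ) : ℂ ≃ₜ ℂ where
  toFun w := w + ((C * w.re ^ 2 : ℝ) : ℂ) * Complex.I
  invFun w := w - ((C * w.re ^ 2 : ℝ) : ℂ) * Complex.I
  left_inv w := by
    apply Complex.ext <;>
      simp only [Complex.add_re, Complex.sub_re, Complex.add_im, Complex.sub_im, Complex.mul_re,
        Complex.mul_im, Complex.ofReal_re, Complex.ofReal_im, Complex.I_re, Complex.I_im] <;> ring_nf
  right_inv w := by
    apply Complex.ext <;>
      simp only [Complex.add_re, Complex.sub_re, Complex.add_im, Complex.sub_im, Complex.mul_re,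
        Complex.mul_im, Complex.ofReal_re, Complex.ofReal_im, Complex.I_re, Complex.I_im] <;> ring_nf
  continuous_toFun := by fun_prop
  continuous_invFun := by fun_prop

/-- A homeomorphism of the plane fixing `0` and putting two points in the upper half plane. -/
theorem exists_good (a b : ℂ) : ∃ Ψ : ℂ ≃ₜ ℂ, Ψ 0 = 0 ∧ (a = 0 ∨ 0 < (Ψ a).im) ∧
    (b = 0 ∨ 0 < (Ψ b).im) := by
  obtain ⟨t, ht⟩ := Infinite.exists_notMem_finset ({a.re / a.im, b.re / b.im} : Finset ℝ)
  simp only [Finset.mem_insert, Finset.mem_singleton, not_or] at ht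
  set u : ℂ := ⟨1, t⟩ with hu
  have hu0 : u ≠ 0 := fun h => by simpa [hu] using congrArg Complex.re h
  have key : ∀ c : ℂ, t ≠ c.re / c.im → c = 0 ∨ (u * c).re ≠ 0 := by
    intro c hc
    by_cases h : c = 0
    · exact Or.inl h
    · right
      simp only [hu, Complex.mul_re, one_mul]
      intro h0
      by_cases hi : c.im = 0
      · apply h; apply Complex.ext <;> simp_all
      · apply hc; field_simp; linarith
  have key2 : ∀ c : ℂ, ∃ C₀ : ℝ, ∀ C ≥ C₀, t ≠ c.re / c.im → c = 0 ∨ 0 < (shear C (u * c)).im := by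
    intro c
    refine ⟨(1 - (u * c).im) / (u * c).re ^ 2, fun C hC hc => ?_⟩
    rcases key c hc with h | h
    · exact Or.inl h
    · right
      have h2 : 0 < (u * c).re ^ 2 := by positivity
      have := (div_le_iff₀ h2).1 hC
      have e : (shear C (u * c)).im = (u * c).im + C * (u * c).re ^ 2 := by
        change ((u * c) + ((C * (u * c).re ^ 2 : ℝ) : ℂ) * Complex.I).im = _
        rw [Complex.add_im, Complex.im_ofReal_mul, Complex.I_im, mul_one]
      linarith
  obtain ⟨C1, h1⟩ := key2 a
  obtain ⟨C2, h2⟩ := key2 b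
  refine ⟨(Homeomorph.mulLeft₀ u hu0).trans (shear (max C1 C2)), ?_, ?_, ?_⟩
  · simp [shear]
  · exact h1 _ (le_max_left _ _) ht.1
  · exact h2 _ (le_max_right _ _) ht.2

theorem mem_tangent (t : ℝ) (ht : 0 ≤ t) (w : ℂ) :
    w ∈ closedBall ((t : ℂ) * Complex.I) t ↔ w.re ^ 2 + w.im ^ 2 ≤ 2 * t * w.im := by
  rw [mem_closedBall, dist_eq_norm, ← abs_of_nonneg ht, ← sq_le_sq₀ (norm_nonneg _) (abs_nonneg _),
    Complex.sq_norm, Complex.normSq_apply, abs_of_nonneg ht]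
  simp
  constructor <;> intro h <;> nlinarith

theorem mem_tangent' (t : ℝ) (ht : 0 ≤ t) (w : ℂ) :
    w ∈ ball ((t : ℂ) * Complex.I) t ↔ w.re ^ 2 + w.im ^ 2 < 2 * t * w.im := by
  rw [mem_ball, dist_eq_norm, ← abs_of_nonneg ht, ← sq_lt_sq₀ (norm_nonneg _) (abs_nonneg _),
    Complex.sq_norm, Complex.normSq_apply, abs_of_nonneg ht]
  simp
  constructor <;> intro h <;> nlinarith

theorem tangent_large (a : ℂ) (ha : a = 0 ∨ 0 < a.im) :
    ∃ t₀ : ℝ, ∀ t ≥ t₀, a.re ^ 2 + a.im ^ 2 ≤ 2 * t * a.im := by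
  rcases ha with rfl | ha
  · exact ⟨0, fun t _ => by simp⟩
  · refine ⟨(a.re ^ 2 + a.im ^ 2) / (2 * a.im), fun t ht => ?_⟩
    have := (div_le_iff₀ (by positivity)).1 ht
    linarith

theorem tangent_smaller (T : ℝ) (hTp : 0 < T) (w : ℂ)
    (h : w.re ^ 2 + w.im ^ 2 < 2 * T * w.im) :
    ∃ s₀ < T, ∀ s ≥ s₀, w.re ^ 2 + w.im ^ 2 ≤ 2 * s * w.im := by
  have hT : 0 < w.im := by
    by_contra hcon
    nlinarith [sq_nonneg w.re, sq_nonneg w.im]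
  refine ⟨(w.re ^ 2 + w.im ^ 2) / (2 * w.im), ?_, fun s hs => ?_⟩
  · rw [div_lt_iff₀ (by positivity)]; linarith
  · have := (div_le_iff₀ (by positivity)).1 hs
    linarith

/-- The growing disk argument. -/
theorem growing {X : Type*} [TopologicalSpace X] [T2Space X] (f : X → X) (hf : Continuous f)
    (H : ℂ → X) (hH : IsOpenEmbedding H) (a b : ℂ) (h0 : f (H 0) ≠ H 0)
    (ha : a = 0 ∨ 0 < a.im) (hb : b = 0 ∨ 0 < b.im) (hab : f (H a) = H b) :
    ∃ D : Set X, D ⊆ range H ∧ Nonempty (↥D ≃ₜ ↥(Metric.closedBall (0:ℂ) 1)) ∧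
      H 0 ∈ frontier D ∧ ((f '' D) ∩ D).Nonempty ∧ (f '' interior D) ∩ interior D = ∅ := by
  obtain ⟨t1, ht1⟩ := tangent_large a ha
  obtain ⟨t2, ht2⟩ := tangent_large b hb
  set M := max 0 (max t1 t2) with hM
  have hM0 : 0 ≤ M := le_max_left _ _
  have hM1 : t1 ≤ M := (le_max_left _ _).trans (le_max_right _ _)
  have hM2 : t2 ≤ M := (le_max_right _ _).trans (le_max_right _ _)
  let Q : ℝ → ℂ → Prop := fun t w => w.re ^ 2 + w.im ^ 2 ≤ 2 * t * w.im
  let K : Set (ℝ × ℂ × ℂ) := {x | x.1 ∈ Icc 0 M ∧ Q x.1 x.2.1 ∧ Q x.1 x.2.2 ∧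
    f (H x.2.1) = H x.2.2}
  have hHc := hH.continuous
  have hKc : IsClosed K := by
    have c1 : IsClosed {x : ℝ × ℂ × ℂ | x.2.1.re ^ 2 + x.2.1.im ^ 2 ≤ 2 * x.1 * x.2.1.im} :=
      isClosed_le (by fun_prop) (by fun_prop)
    have c2 : IsClosed {x : ℝ × ℂ × ℂ | x.2.2.re ^ 2 + x.2.2.im ^ 2 ≤ 2 * x.1 * x.2.2.im} :=
      isClosed_le (by fun_prop) (by fun_prop)
    have c3 : IsClosed {x : ℝ × ℂ × ℂ | f (H x.2.1) = H x.2.2} :=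
      isClosed_eq (by fun_prop) (by fun_prop)
    exact (isClosed_Icc.preimage continuous_fst).inter (c1.inter (c2.inter c3))
  have hQ : ∀ t w, 0 ≤ t → t ≤ M → Q t w → w ∈ closedBall (0:ℂ) (2 * M) := by
    intro t w h0 h1 h2
    have := (mem_tangent t h0 w).2 h2
    rw [mem_closedBall] at this ⊢
    have h3 := dist_triangle w ((t : ℂ) * Complex.I) 0
    have h4 : dist ((t : ℂ) * Complex.I) 0 = t := by simp [abs_of_nonneg h0]
    linarith
  have hK : IsCompact K := by
    apply IsCompact.of_isClosed_subset
      ((isCompact_Icc (a := (0:ℝ)) (b := M)).prod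
      ((isCompact_closedBall (0:ℂ) (2 * M)).prod (isCompact_closedBall (0:ℂ) (2 * M)))) hKc
    rintro ⟨t, w, w'⟩ ⟨h1, h2, h3, h4⟩
    exact ⟨h1, hQ t w h1.1 h1.2 h2, hQ t w' h1.1 h1.2 h3⟩
  have hKn : K.Nonempty := ⟨(M, a, b), ⟨hM0, le_rfl⟩, ht1 _ hM1, ht2 _ hM2, hab⟩
  obtain ⟨⟨T, w, w'⟩, ⟨hT, hw, hw', hfw⟩, hmin⟩ := hK.exists_isMinOn hKn continuous_fst.continuousOn
  simp only at hT hw hw' hfw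
  have hzero : ∀ v, Q 0 v → v = 0 := by
    intro v hv
    have hv : v.re ^ 2 + v.im ^ 2 ≤ 2 * 0 * v.im := hv
    apply Complex.ext <;> simp <;> nlinarith [sq_nonneg v.re, sq_nonneg v.im]
  have hTpos : 0 < T := by
    rcases hT.1.eq_or_lt with h | h
    · rw [← h] at hw hw'
      rw [hzero _ hw, hzero _ hw'] at hfw
      exact absurd hfw h0
    · exact h
  let B := closedBall ((T : ℂ) * Complex.I) T
  have hint : interior (H '' B) ⊆ H '' (ball ((T : ℂ) * Complex.I) T) := by
    rw [← interior_closedBall _ hTpos.ne']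
    intro y hy
    obtain ⟨v, hv, rfl⟩ := interior_subset hy
    refine ⟨v, ?_, rfl⟩
    have : H ⁻¹' (interior (H '' B)) ⊆ interior B := by
      apply interior_maximal
      · intro s hs
        obtain ⟨s', hs', e⟩ := interior_subset hs
        rwa [← hH.injective e]
      · exact isOpen_interior.preimage hHc
    exact this hy
  refine ⟨H '' B, image_subset_range _ _, ?_, ?_, ?_, ?_⟩
  · let e : ℂ ≃ₜ ℂ := (Homeomorph.mulLeft₀ (T : ℂ) (by exact_mod_cast hTpos.ne')).trans
      (Homeomorph.addLeft ((T : ℂ) * Complex.I))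
    have hB : B = e '' closedBall 0 1 := by
      apply Subset.antisymm
      · intro v hv
        refine ⟨e.symm v, ?_, e.apply_symm_apply v⟩
        obtain ⟨s, rfl⟩ := e.surjective v
        rw [e.symm_apply_apply]
        have : dist (e s) ((T : ℂ) * Complex.I) = T * ‖s‖ := by
          simp [e, dist_eq_norm, abs_of_pos hTpos]
        rw [mem_closedBall, this] at hv
        rw [mem_closedBall_zero_iff]
        by_contra hcon
        nlinarith
      · rintro _ ⟨s, hs, rfl⟩
        have : dist (e s) ((T : ℂ) * Complex.I) = T * ‖s‖ := by
          simp [e, dist_eq_norm, abs_of_pos hTpos]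
        rw [mem_closedBall, this]
        rw [mem_closedBall_zero_iff] at hs
        nlinarith
    rw [hB, ← image_comp]
    exact ⟨((hH.isEmbedding.comp e.isEmbedding).homeomorphImage _).symm⟩
  · refine ⟨subset_closure ⟨0, ?_, rfl⟩, fun h => ?_⟩
    · exact (mem_tangent T hTpos.le 0).2 (by simp)
    · obtain ⟨v, hv, e⟩ := hint h
      rw [hH.injective e] at hv
      have := (mem_tangent' T hTpos.le 0).1 hv
      simp at this
  · exact ⟨H w', ⟨H w, ⟨w, (mem_tangent T hTpos.le w).2 hw, rfl⟩, hfw⟩,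
      ⟨w', (mem_tangent T hTpos.le w').2 hw', rfl⟩⟩
  · rw [Set.eq_empty_iff_forall_notMem]
    rintro y ⟨⟨x, hx, hxy⟩, hy⟩
    obtain ⟨v, hv, rfl⟩ := hint hx
    obtain ⟨v', hv', rfl⟩ := hint hy
    obtain ⟨s1, hs1, k1⟩ := tangent_smaller T hTpos v ((mem_tangent' T hTpos.le v).1 hv)
    obtain ⟨s2, hs2, k2⟩ := tangent_smaller T hTpos v' ((mem_tangent' T hTpos.le v').1 hv')
    set s := max 0 (max s1 s2) with hs
    have hsT : s < T := max_lt hTpos (max_lt hs1 hs2)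
    have hmem : ((s, v, v') : ℝ × ℂ × ℂ) ∈ K :=
      ⟨⟨le_max_left _ _, hsT.le.trans hT.2⟩, k1 _ ((le_max_left _ _).trans (le_max_right _ _)),
        k2 _ ((le_max_right _ _).trans (le_max_right _ _)), hxy⟩
    have := hmin hmem
    simp only [mem_ofPred_eq] at this
    linarith

/-- The local statement. -/
theorem local_disk (f : ↥Disk ≃ₜ ↥Disk) (U : Set ℂ) (hU : IsOpen U) (hc : IsPreconnected U)
    (hUD : U ⊆ Disk) (p x : ↥Disk) (hp : p.1 ∈ U) (hx : x.1 ∈ U) (hfx : (f x).1 ∈ U)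
    (hfp : f p ≠ p) :
    ∃ D : Set ↥Disk, (∀ y ∈ D, y.1 ∈ U) ∧ IsClosedDisk D ∧ p ∈ frontier D ∧
      ((⇑f '' D) ∩ D).Nonempty ∧ (⇑f '' interior D) ∩ interior D = ∅ := by
  obtain ⟨H, hH, hHU, ⟨p', hp'⟩, ⟨x', hx'⟩, ⟨y', hy'⟩⟩ := exists_emb U hU hc p x (f x) hp hx hfx
  obtain ⟨Ψ, hΨ0, hΨa, hΨb⟩ := exists_good (x' - p') (y' - p')
  let G : ℂ → ℂ := H ∘ (Homeomorph.addLeft p') ∘ Ψ.symm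
  have hG : IsOpenEmbedding G := hH.comp ((Homeomorph.addLeft p').isOpenEmbedding.comp
    Ψ.symm.isOpenEmbedding)
  have hGU : ∀ w, G w ∈ U := fun w => hHU (mem_range_self _)
  let G' : ℂ → ↥Disk := fun w => ⟨G w, hUD (hGU w)⟩
  have hG' : IsOpenEmbedding G' := by
    apply IsOpenEmbedding.of_comp G' (g := Subtype.val) isOpen_ball.isOpenEmbedding_subtypeVal
    exact hG
  have hGΨ : ∀ c, G (Ψ (c - p')) = H c := by
    intro c; simp [G]
  have e0 : G' 0 = p := by
    apply Subtype.ext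
    change G 0 = p
    have := hGΨ p'
    rwa [sub_self, hΨ0, hp'] at this
  have ea : G' (Ψ (x' - p')) = x := Subtype.ext ((hGΨ x').trans hx')
  have eb : G' (Ψ (y' - p')) = f x := Subtype.ext ((hGΨ y').trans hy')
  have conv : ∀ c : ℂ, (c = 0 ∨ 0 < (Ψ c).im) → (Ψ c = 0 ∨ 0 < (Ψ c).im) := by
    rintro c (rfl | h)
    · exact Or.inl hΨ0
    · exact Or.inr h
  obtain ⟨D, d1, d2, d3, d4, d5⟩ := growing f f.continuous G' hG' (Ψ (x' - p')) (Ψ (y' - p'))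
    (by rw [e0]; exact hfp) (conv _ hΨa) (conv _ hΨb) (by rw [ea, eb])
  refine ⟨D, fun y hy => ?_, d2, e0 ▸ d3, d4, d5⟩
  obtain ⟨w, rfl⟩ := d1 hy
  exact hGU w

theorem preconnected_thickening (s : Set ℂ) (hs : IsPreconnected s) (δ : ℝ) :
    IsPreconnected (thickening δ s) := by
  rw [← add_ball_zero, ← Set.add_image_prod]
  exact (hs.prod (convex_ball (0:ℂ) δ).isPreconnected).image _ continuous_add.continuousOn

/-- Compact disjoint sets are at positive distance. -/
theorem sep (s t : Set ℂ) (hs : IsCompact s) (ht : IsCompact t) (h : Disjoint s t) :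
    ∃ δ > 0, ∀ a ∈ s, ∀ b ∈ t, δ ≤ dist a b := by
  obtain ⟨δ, h0, hd⟩ := h.exists_thickenings hs ht.isClosed
  refine ⟨δ, h0, fun a ha b hb => ?_⟩
  by_contra hcon
  rw [not_le] at hcon
  exact Set.disjoint_left.1 hd (mem_thickening_iff.2 ⟨a, ha, by rw [dist_self]; exact h0⟩)
    (mem_thickening_iff.2 ⟨b, hb, hcon⟩)

/-- Uniform separation of one segment from all the others. -/
theorem sep_all (α ω : ℂ) (hα : α ∈ Metric.sphere (0:ℂ) 1) (hω : ω ∈ Metric.sphere (0:ℂ) 1)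
    (γ : ℤ → Set ↥Disk) (hcomp : ∀ k, IsCompact (γ k))
    (hdisj : Pairwise fun k k' => Disjoint (γ k) (γ k'))
    (hconvₘ : TendstoSetsBot γ α) (hconvₚ : TendstoSetsTop γ ω) (k : ℤ) :
    ∃ δ > 0, ∀ j ≠ k, ∀ a ∈ γ k, ∀ b ∈ γ j, δ ≤ dist a.1 b.1 := by
  have hc : ∀ k, IsCompact (Subtype.val '' γ k) := fun k => (hcomp k).image continuous_subtype_val
  have hout : ∀ p ∈ Metric.sphere (0:ℂ) 1, ∃ δ > 0, ∀ a ∈ γ k, δ ≤ dist a.1 p := by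
    intro p hp
    obtain ⟨δ, h0, h⟩ := sep (Subtype.val '' γ k) {p} (hc k) isCompact_singleton (by
      rw [Set.disjoint_singleton_right]
      rintro ⟨a, _, rfl⟩
      have := a.2
      rw [mem_ball] at this
      rw [mem_sphere] at hp
      linarith)
    exact ⟨δ, h0, fun a ha => h _ (mem_image_of_mem _ ha) _ rfl⟩
  obtain ⟨r1, hr1, h1⟩ := hout α hα
  obtain ⟨r2, hr2, h2⟩ := hout ω hω
  obtain ⟨N1, hN1⟩ := hconvₘ (r1 / 2) (by positivity)
  obtain ⟨N2, hN2⟩ := hconvₚ (r2 / 2) (by positivity)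
  have hfin : ∀ j ∈ Icc N1 N2, ∀ᶠ δ in 𝓝[>] (0:ℝ), j ≠ k → ∀ a ∈ γ k, ∀ b ∈ γ j, δ ≤ dist a.1 b.1 := by
    intro j _
    by_cases hj : j = k
    · exact Eventually.of_forall fun δ h => absurd hj h
    · obtain ⟨d, hd, h⟩ := sep (Subtype.val '' γ k) (Subtype.val '' γ j) (hc k) (hc j)
        ((Set.disjoint_image_iff Subtype.val_injective).2 (hdisj (Ne.symm hj)))
      filter_upwards [Ioo_mem_nhdsGT hd] with δ hδ _ a ha b hb
      exact hδ.2.le.trans (h _ (mem_image_of_mem _ ha) _ (mem_image_of_mem _ hb))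
  have hall := (Set.finite_Icc N1 N2).eventually_all.2 hfin
  have hmn : (0:ℝ) < min (r1 / 2) (r2 / 2) := by positivity
  have hev : ∀ᶠ δ in 𝓝[>] (0:ℝ), δ ∈ Ioo (0:ℝ) (min (r1 / 2) (r2 / 2)) := Ioo_mem_nhdsGT hmn
  obtain ⟨δ, hδ, hpos, hlt⟩ := (hall.and hev).exists
  refine ⟨δ, hpos, fun j hj a ha b hb => ?_⟩
  rw [lt_min_iff] at hlt
  by_cases hj1 : j ≤ N1
  · have e1 := hN1 j hj1 b hb
    have e2 := h1 a ha
    have := dist_triangle a.1 b.1 α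
    linarith
  · by_cases hj2 : N2 ≤ j
    · have e1 := hN2 j hj2 b hb
      have e2 := h2 a ha
      have := dist_triangle a.1 b.1 ω
      linarith
    · exact hδ j ⟨by omega, by omega⟩ hj a ha b hb

/-- Lemma 3.3 (derived from the conclusion of Lemma 3.2). -/
theorem handel_lem_3_3 (f : ↥Disk ≃ₜ ↥Disk) (z : ↥Disk) (α ω : ℂ)
    (hα : α ∈ Metric.sphere (0:ℂ) 1) (hω : ω ∈ Metric.sphere (0:ℂ) 1) (hαω : α ≠ ω)
    (γ : ℤ → Set ↥Disk)
    (hseg : ∀ k, IsSegmentSet (γ k))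
    (hdisj : Pairwise fun k k' => Disjoint (γ k) (γ k'))
    (hmem : ∀ k, fiter f k z ∈ γ k)
    (hfix : ∀ k, ∀ x ∈ γ k, f x ≠ x)
    (hmeet : ∀ k, ((⇑f '' γ k) ∩ γ k).Nonempty)
    (hconvₘ : TendstoSetsBot γ α) (hconvₚ : TendstoSetsTop γ ω) :
    ∃ D : ℤ → Set ↥Disk,
      (∀ k, IsClosedDisk (D k)) ∧
      (Pairwise fun k k' => Disjoint (D k) (D k')) ∧
      (∀ k, fiter f k z ∈ frontier (D k)) ∧
      (∀ k, ∀ x ∈ D k, f x ≠ x) ∧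
      (∀ k, ((⇑f '' D k) ∩ D k).Nonempty) ∧
      (∀ k, (⇑f '' interior (D k)) ∩ interior (D k) = ∅) ∧
      TendstoSetsBot D α ∧ TendstoSetsTop D ω := by
  have hcomp : ∀ k, IsCompact (γ k) := by
    intro k
    obtain ⟨a, b, g, hg, _, _, _, he⟩ := hseg k
    rw [he]
    exact isCompact_Icc.image_of_continuousOn hg
  have hconn : ∀ k, IsPreconnected (γ k) := by
    intro k
    obtain ⟨a, b, g, hg, _, _, _, he⟩ := hseg k
    rw [he]
    exact isPreconnected_Icc.image _ hg
  let O : Set ℂ := Subtype.val '' {x : ↥Disk | f x ≠ x}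
  have hO : IsOpen O := by
    apply isOpen_ball.isOpenEmbedding_subtypeVal.isOpenMap
    exact isOpen_ne_fun f.continuous continuous_id
  have key : ∀ k : ℤ, ∃ δ > 0, (∀ j ≠ k, ∀ a ∈ γ k, ∀ b ∈ γ j, δ ≤ dist a.1 b.1) ∧
      thickening δ (Subtype.val '' γ k) ⊆ O ∧ δ ≤ 1 / (|(k : ℝ)| + 1) := by
    intro k
    obtain ⟨d1, h1, e1⟩ := sep_all α ω hα hω γ hcomp hdisj hconvₘ hconvₚ k
    obtain ⟨d2, h2, e2⟩ := ((hcomp k).image continuous_subtype_val).exists_thickening_subset_open hO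
      (image_mono fun x hx => hfix k x hx)
    refine ⟨min (min d1 d2) (1 / (|(k : ℝ)| + 1)), by positivity, fun j hj a ha b hb => ?_,
      ?_, min_le_right _ _⟩
    · exact ((min_le_left _ _).trans (min_le_left _ _)).trans (e1 j hj a ha b hb)
    · exact (thickening_mono ((min_le_left _ _).trans (min_le_right _ _)) _).trans e2
  choose δ hδ0 hδ1 hδ2 hδ3 using key
  let U : ℤ → Set ℂ := fun k => thickening (δ k / 2) (Subtype.val '' γ k)
  have hUO : ∀ k, U k ⊆ O := fun k =>
    (thickening_mono (by linarith [hδ0 k]) _).trans (hδ2 k)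
  have hγU : ∀ k, ∀ x ∈ γ k, x.1 ∈ U k := fun k x hx =>
    mem_thickening_iff.2 ⟨x.1, mem_image_of_mem _ hx, by rw [dist_self]; linarith [hδ0 k]⟩
  have hloc : ∀ k, ∃ D : Set ↥Disk, (∀ y ∈ D, y.1 ∈ U k) ∧ IsClosedDisk D ∧
      fiter f k z ∈ frontier D ∧
      ((⇑f '' D) ∩ D).Nonempty ∧ (⇑f '' interior D) ∩ interior D = ∅ := by
    intro k
    obtain ⟨_, ⟨x, hx, rfl⟩, hfx⟩ := hmeet k
    refine local_disk f (U k) isOpen_thickening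
      (preconnected_thickening _ ((hconn k).image _ continuous_subtype_val.continuousOn) _)
      ?_ (fiter f k z) x (hγU k _ (hmem k)) (hγU k _ hx) (hγU k _ hfx) (hfix k _ (hmem k))
    intro w hw
    obtain ⟨v, _, rfl⟩ := hUO k hw
    exact v.2
  choose D hDU hD1 hD2 hD3 hD4 using hloc
  have hnear : ∀ k, ∀ x ∈ D k, ∃ y ∈ γ k, dist x.1 y.1 < δ k / 2 := by
    intro k x hx
    obtain ⟨_, ⟨y, hy, rfl⟩, h⟩ := mem_thickening_iff.1 (hDU k x hx)
    exact ⟨y, hy, h⟩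
  have hsmall : ∀ ε > (0:ℝ), ∃ n : ℤ, 0 ≤ n ∧ ∀ k : ℤ, n ≤ |k| → δ k < ε := by
    intro ε hε
    obtain ⟨n, hn⟩ := exists_nat_gt (1 / ε)
    refine ⟨n, by positivity, fun k hk => (hδ3 k).trans_lt ?_⟩
    have hk' : (n : ℝ) ≤ |(k : ℝ)| := by exact_mod_cast hk
    rw [div_lt_iff₀ (by positivity)]
    rw [div_lt_iff₀ hε] at hn
    nlinarith
  refine ⟨D, hD1, ?_, hD2, ?_, hD3, hD4, ?_, ?_⟩
  · intro k k' hkk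
    rw [Set.disjoint_left]
    intro x hx hx'
    obtain ⟨y, hy, h⟩ := hnear k x hx
    obtain ⟨y', hy', h'⟩ := hnear k' x hx'
    have e1 := hδ1 k k' hkk.symm y hy y' hy'
    have e2 := hδ1 k' k hkk y' hy' y hy
    rw [dist_comm] at e2
    have := dist_triangle_left y.1 y'.1 x.1
    linarith
  · intro k x hx
    obtain ⟨v, hv, e⟩ := hUO k (hDU k x hx)
    rw [← Subtype.ext e]
    exact hv
  · intro ε hε
    obtain ⟨N, hN⟩ := hconvₘ (ε / 2) (by positivity)
    obtain ⟨n, hn0, hn⟩ := hsmall ε hε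
    refine ⟨min N (-n), fun k hk x hx => ?_⟩
    obtain ⟨y, hy, h⟩ := hnear k x hx
    have e1 := hN k (hk.trans (min_le_left _ _)) y hy
    have e2 := hn k (by have := hk.trans (min_le_right _ _); rw [abs_of_nonpos] <;> omega)
    have := dist_triangle x.1 y.1 α
    linarith
  · intro ε hε
    obtain ⟨N, hN⟩ := hconvₚ (ε / 2) (by positivity)
    obtain ⟨n, hn0, hn⟩ := hsmall ε hε
    refine ⟨max N n, fun k hk x hx => ?_⟩
    obtain ⟨y, hy, h⟩ := hnear k x hx
    have e1 := hN k ((le_max_left _ _).trans hk) y hy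
    have e2 := hn k (by have := (le_max_right N n).trans hk; rw [abs_of_nonneg] <;> omega)
    have := dist_triangle x.1 y.1 ω
    linarith
end
end

section
/- Let f be a homeomorphism of the open unit disk 𝔻, let z ∈ 𝔻 and let α, ω be two distinct points of S¹. Suppose given a sequence (D'^k)_{k∈ℤ} of pairwise disjoint closed disks in 𝔻 such that for every k ∈ ℤ: f^k(z) ∈ ∂D'^k; D'^k ∩ Fix(f) = ∅; f(D'^k) ∩ D'^k ≠ ∅; f(Int(D'^k)) ∩ Int(D'^k) = ∅; and (D'^k) converges to {α} as k → −∞ and to {ω} as k → +∞. Then at least one of the following holds: (i) f is recurrent; (ii) there exists a sequence (D^k)_{k∈ℤ} of pairwise disjoint closed disks in 𝔻 such that for every k ∈ ℤ: f^k(z) ∈ Int(D^k); D^k ∩ Fix(f) = ∅; f(D^k) ∩ D^k ≠ ∅; f(D^k) ∩ D^{k'} = ∅ and f²(D^k) ∩ D^{k'} = ∅ for every k' < k; and (D^k) converges to {α} as k → −∞ and to {ω} as k → +∞. (Lemma 3.4, derived from the conclusion of Lemma 3.3.) -/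
open Set Filter Metric Topology

noncomputable section

/-- existence of a continuous logarithm. -/
def HasCLog {X : Type*} [TopologicalSpace X] (φ : X → ℂ) : Prop :=
  ∃ ψ : X → ℂ, Continuous ψ ∧ ∀ x, Complex.exp (ψ x) = φ x

lemma HasCLog.of_close {X : Type*} [TopologicalSpace X] {φ φ' : X → ℂ} (h : HasCLog φ)
    (hc : Continuous φ') (hcl : ∀ x, ‖φ' x - φ x‖ < ‖φ x‖) : HasCLog φ' := by
  obtain ⟨ψ, hψ, he⟩ := h
  have hne : ∀ x, φ x ≠ 0 := fun x => by rw [← he]; exact Complex.exp_ne_zero _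
  have hφ : Continuous φ := by
    have : φ = fun x => Complex.exp (ψ x) := by funext x; rw [he]
    rw [this]; fun_prop
  have hs : ∀ x, φ' x / φ x ∈ Complex.slitPlane := by
    intro x
    have h1 : φ' x / φ x = 1 + (φ' x - φ x) / φ x := by
      have := hne x
      field_simp; ring
    rw [h1]
    apply Complex.mem_slitPlane_of_norm_lt_one
    rw [norm_div, div_lt_one (norm_pos_iff.2 (hne x))]
    exact hcl x
  refine ⟨fun x => ψ x + Complex.log (φ' x / φ x), ?_, ?_⟩
  · exact hψ.add ((hc.div hφ hne).clog hs)
  · intro x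
    have h0 := Complex.slitPlane_ne_zero (hs x)
    rw [Complex.exp_add, he, Complex.exp_log h0]
    have := hne x
    field_simp

lemma HasCLog.const {X : Type*} [TopologicalSpace X] {c : ℂ} (hc : c ≠ 0) :
    HasCLog (fun _ : X => c) :=
  ⟨fun _ => Complex.log c, continuous_const, fun _ => Complex.exp_log hc⟩

lemma HasCLog.homotopy {X : Type*} [TopologicalSpace X] [CompactSpace X]
    (Φ : unitInterval × X → ℂ) (hΦ : Continuous Φ) (hne : ∀ p, Φ p ≠ 0)
    (h0 : HasCLog (fun x => Φ (0, x))) : HasCLog (fun x => Φ (1, x)) := by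
  have key : ∀ t : unitInterval, ∀ᶠ s in 𝓝 t,
      (HasCLog (fun x => Φ (t, x)) ↔ HasCLog (fun x => Φ (s, x))) := by
    intro t
    have h1 : ∀ᶠ s in 𝓝 t, ∀ x ∈ (univ : Set X),
        ‖Φ (s, x) - Φ (t, x)‖ < ‖Φ (t, x)‖ ∧ ‖Φ (t, x) - Φ (s, x)‖ < ‖Φ (s, x)‖ := by
      apply isCompact_univ.eventually_forall_of_forall_eventually
      intro x _
      have hp : 0 < ‖Φ (t, x)‖ := norm_pos_iff.2 (hne _)
      have o : IsOpen {y : unitInterval × X | ‖Φ (y.1, y.2) - Φ (t, y.2)‖ < ‖Φ (t, y.2)‖ ∧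
          ‖Φ (t, y.2) - Φ (y.1, y.2)‖ < ‖Φ (y.1, y.2)‖} := by
        have e1 : Continuous fun y : unitInterval × X => Φ (y.1, y.2) := by fun_prop
        have e2 : Continuous fun y : unitInterval × X => Φ (t, y.2) := by fun_prop
        exact (isOpen_lt (e1.sub e2).norm e2.norm).inter (isOpen_lt (e2.sub e1).norm e1.norm)
      exact o.mem_nhds (by simpa using hp)
    filter_upwards [h1] with s hs
    constructor
    · intro h
      exact h.of_close (by fun_prop) (fun x => (hs x trivial).1)
    · intro h
      exact h.of_close (by fun_prop) (fun x => (hs x trivial).2)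
  have := PreconnectedSpace.induction₂' (α := unitInterval)
    (fun t s => HasCLog (fun x => Φ (t, x)) ↔ HasCLog (fun x => Φ (s, x)))
    (fun t => (key t).mono fun s hs => ⟨hs, hs.symm⟩)
    ⟨fun _ _ _ a b => a.trans b⟩ 0 1
  exact this.1 h0

lemma not_hasCLog_odd (φ : sphere (0 : ℂ) 1 → ℂ) (hodd : ∀ s, φ (-s) = - φ s) :
    ¬ HasCLog φ := by
  rintro ⟨ψ, hψ, he⟩
  have : PreconnectedSpace (sphere (0 : ℂ) 1) :=
    isPreconnected_iff_preconnectedSpace.1 (isPreconnected_sphere (by simp) 0 1)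
  let u : sphere (0 : ℂ) 1 → ℝ := fun s => (ψ s - ψ (-s)).im
  have hu : Continuous u := by
    have : Continuous fun s : sphere (0 : ℂ) 1 => -s := continuous_neg
    exact Complex.continuous_im.comp (hψ.sub (hψ.comp this))
  have hun : ∀ s, u (-s) = - u s := by intro s; simp [u]
  have hz : ∃ s, u s = 0 := by
    let s0 : sphere (0 : ℂ) 1 := ⟨1, by simp⟩
    rcases le_total (u s0) 0 with h | h
    · exact mem_range_of_exists_le_of_exists_ge hu ⟨s0, h⟩ ⟨-s0, by rw [hun]; linarith⟩
    · exact mem_range_of_exists_le_of_exists_ge hu ⟨-s0, by rw [hun]; linarith⟩ ⟨s0, h⟩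
  obtain ⟨s, hs⟩ := hz
  have h1 : Complex.exp (ψ s - ψ (-s)) = -1 := by
    rw [Complex.exp_sub, he, he, hodd]
    have : φ s ≠ 0 := by rw [← he]; exact Complex.exp_ne_zero _
    field_simp
  have h2 : ψ s - ψ (-s) = (((ψ s - ψ (-s)).re : ℝ) : ℂ) := by
    apply Complex.ext
    · simp
    · simpa [u] using hs
  rw [h2, ← Complex.ofReal_exp] at h1
  have h3 : Real.exp (ψ s - ψ (-s)).re = -1 := by exact_mod_cast h1
  have := Real.exp_pos (ψ s - ψ (-s)).re
  linarith

lemma invariance_aux (k : ℂ → ℂ) (hk : ContinuousOn k (closedBall 0 1))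
    (hi : InjOn k (closedBall 0 1)) : k 0 ∈ interior (k '' closedBall 0 1) := by
  by_contra hp
  have hJ : IsCompact (k '' sphere 0 1) :=
    (isCompact_sphere (0 : ℂ) 1).image_of_continuousOn (hk.mono sphere_subset_closedBall)
  have hpJ : k 0 ∈ (k '' sphere 0 1)ᶜ := by
    rintro ⟨s, hs, hs'⟩
    have := hi (sphere_subset_closedBall hs) (by simp) hs'
    subst this
    simp at hs
  obtain ⟨δ, hδ, hB⟩ := Metric.isOpen_iff.1 hJ.isClosed.isOpen_compl _ hpJ
  obtain ⟨q, hqd, hq⟩ : ∃ q, dist q (k 0) < δ / 2 ∧ q ∉ k '' closedBall 0 1 := by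
    by_contra! hcon
    exact hp (mem_interior.2 ⟨ball (k 0) (δ / 2), fun q hq => hcon q hq, isOpen_ball,
      mem_ball_self (by positivity)⟩)
  have hmem : ∀ (t : ℝ) (s : sphere (0 : ℂ) 1), |t| ≤ 1 → (t : ℂ) * s.1 ∈ closedBall (0 : ℂ) 1 := by
    intro t s ht
    have : ‖s.1‖ = 1 := by simpa using s.2
    simpa [this] using ht
  have hcomp : ∀ (T : unitInterval × sphere (0 : ℂ) 1 → ℝ), Continuous T → (∀ y, |T y| ≤ 1) →
      Continuous (fun y : unitInterval × sphere (0 : ℂ) 1 => k ((T y : ℂ) * y.2.1)) := by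
    intro T hT hT1
    exact hk.comp_continuous (by fun_prop) (fun y => hmem _ _ (hT1 y))
  have hks : Continuous fun s : sphere (0 : ℂ) 1 => k s.1 :=
    hk.comp_continuous (by fun_prop) (fun y => sphere_subset_closedBall y.2)
  have habs : ∀ t : unitInterval, |(t : ℝ)| ≤ 1 := fun t => by
    rw [abs_of_nonneg t.2.1]; exact t.2.2
  -- step 1
  have L1 : HasCLog (fun s : sphere (0 : ℂ) 1 => k s.1 - q) := by
    have := HasCLog.homotopy
      (fun y : unitInterval × sphere (0 : ℂ) 1 => k (((y.1 : ℝ) : ℂ) * y.2.1) - q)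
      ((hcomp (fun y => (y.1 : ℝ)) (by fun_prop) (fun y => habs _)).sub continuous_const)
      (fun y h => hq ⟨_, hmem _ y.2 (habs y.1), sub_eq_zero.1 h⟩) (by
        have : k 0 - q ≠ 0 := fun h => hq ⟨0, by simp, sub_eq_zero.1 h⟩
        simpa using HasCLog.const this)
    simpa using this
  have L2 : HasCLog (fun s : sphere (0 : ℂ) 1 => k s.1 - k 0) := by
    refine L1.of_close (hks.sub continuous_const) ?_
    intro s
    have h1 : ¬ dist (k s.1) (k 0) < δ := fun h => hB h ⟨s.1, s.2, rfl⟩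
    have h2 := dist_triangle (k s.1) q (k 0)
    have h3 : k s.1 - k 0 - (k s.1 - q) = q - k 0 := by ring
    rw [h3, ← dist_eq_norm, ← dist_eq_norm]
    linarith
  have hpos : ∀ t : unitInterval, 0 < 1 + (t : ℝ) := fun t => by have := t.2.1; linarith
  have L3 := HasCLog.homotopy
      (fun y : unitInterval × sphere (0 : ℂ) 1 =>
        k (((1 / (1 + (y.1 : ℝ)) : ℝ) : ℂ) * y.2.1) -
        k (((-(y.1 : ℝ) / (1 + (y.1 : ℝ)) : ℝ) : ℂ) * y.2.1))
      (by
        refine (hcomp (fun y => 1 / (1 + (y.1 : ℝ))) ?_ ?_).sub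
          (hcomp (fun y => -(y.1 : ℝ) / (1 + (y.1 : ℝ))) ?_ ?_)
        · exact Continuous.div (by fun_prop) (by fun_prop) (fun y => (hpos y.1).ne')
        · intro y
          rw [abs_div, abs_one, abs_of_pos (hpos _), div_le_one (hpos _)]
          linarith [y.1.2.1]
        · exact Continuous.div (by fun_prop) (by fun_prop) (fun y => (hpos y.1).ne')
        · intro y
          rw [abs_div, abs_neg, abs_of_pos (hpos _), abs_of_nonneg y.1.2.1, div_le_one (hpos _)]
          linarith [y.1.2.1])
      (by
        intro y h
        have h1 := hi (hmem _ _ ?_) (hmem _ _ ?_) (sub_eq_zero.1 h)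
        · have hs : y.2.1 ≠ 0 := by
            have : ‖y.2.1‖ = 1 := by simpa using y.2.2
            intro h; simp [h] at this
          have h2 := mul_right_cancel₀ hs h1
          have h3 : 1 / (1 + (y.1 : ℝ)) = -(y.1 : ℝ) / (1 + (y.1 : ℝ)) := by exact_mod_cast h2
          have := hpos y.1
          field_simp at h3
          linarith
        · rw [abs_div, abs_one, abs_of_pos (hpos _), div_le_one (hpos _)]
          linarith [y.1.2.1]
        · rw [abs_div, abs_neg, abs_of_pos (hpos _), abs_of_nonneg y.1.2.1, div_le_one (hpos _)]
          linarith [y.1.2.1])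
      (by simpa using L2)
  refine not_hasCLog_odd _ ?_ L3
  intro s
  simp [neg_div]

open Classical in
lemma invariance (h : closedBall (0 : ℂ) 1 → ℂ) (hc : Continuous h) (hi : Function.Injective h)
    (a : closedBall (0 : ℂ) 1) (ha : ‖a.1‖ < 1) : h a ∈ interior (range h) := by
  set r : ℝ := 1 - ‖a.1‖ with hr
  have hr0 : 0 < r := by linarith
  let g : ℂ → ℂ := fun w => if hw : w ∈ closedBall (0 : ℂ) 1 then h ⟨w, hw⟩ else 0
  have hgeq : ∀ (w : ℂ) (hw : w ∈ closedBall (0 : ℂ) 1), g w = h ⟨w, hw⟩ := fun w hw => by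
    simp only [g, dif_pos hw]
  have hgc : ContinuousOn g (closedBall 0 1) := by
    rw [continuousOn_iff_continuous_domRestrict]
    convert hc using 1
    funext w
    exact hgeq w.1 w.2
  have hmaps : ∀ w ∈ closedBall (0 : ℂ) 1, a.1 + r * w ∈ closedBall (0 : ℂ) 1 := by
    intro w hw
    have hw' : ‖w‖ ≤ 1 := by simpa using hw
    have h1 := norm_add_le a.1 (r * w)
    have h2 : ‖(r : ℂ) * w‖ = r * ‖w‖ := by simp [abs_of_pos hr0]
    have h3 : r * ‖w‖ ≤ r := by nlinarith
    simp only [mem_closedBall_zero_iff]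
    linarith
  have := invariance_aux (fun w => g (a.1 + r * w))
    (hgc.comp (by fun_prop) hmaps) (by
      intro x hx y hy hxy
      simp only [hgeq _ (hmaps x hx), hgeq _ (hmaps y hy)] at hxy
      have h1 := congrArg Subtype.val (hi hxy)
      have : (r : ℂ) ≠ 0 := by exact_mod_cast hr0.ne'
      simpa [this] using h1)
  have e : g (a.1 + r * 0) = h a := by
    have := hgeq a.1 a.2
    simpa using this
  simp only [e] at this
  refine interior_mono ?_ this
  rintro _ ⟨w, hw, rfl⟩
  exact ⟨_, (hgeq _ (hmaps w hw)).symm⟩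

lemma ball_move (c q : ℂ) (r : ℝ) (hr : 0 < r) (hq : q ∈ ball c r) :
    ∃ g : ℂ ≃ₜ ℂ, g c = q ∧ ∀ x, x ∉ ball c r → g x = x := by
  have hq' : ‖q - c‖ < r := by rwa [mem_ball, dist_eq_norm] at hq
  let f : ℂ → ℂ := fun x => x + ((max 0 (1 - ‖x - c‖ / r) : ℝ) : ℂ) * (q - c)
  obtain ⟨C, hC⟩ : ∃ C : NNReal, (C : ℝ) = ‖q - c‖ / r :=
    ⟨Real.toNNReal (‖q - c‖ / r), Real.coe_toNNReal _ (by positivity)⟩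
  have hA : ApproximatesLinearOn f ((ContinuousLinearEquiv.refl ℝ ℂ : ℂ ≃L[ℝ] ℂ) : ℂ →L[ℝ] ℂ)
      univ C := by
    intro x _ y _
    have e : f x - f y - ((ContinuousLinearEquiv.refl ℝ ℂ : ℂ ≃L[ℝ] ℂ) : ℂ →L[ℝ] ℂ) (x - y) =
        ((max 0 (1 - ‖x - c‖ / r) - max 0 (1 - ‖y - c‖ / r) : ℝ) : ℂ) * (q - c) := by
      simp [f]; ring
    rw [e, norm_mul, Complex.norm_real, Real.norm_eq_abs]
    have h1 : |max 0 (1 - ‖x - c‖ / r) - max 0 (1 - ‖y - c‖ / r)| ≤ ‖x - y‖ / r := by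
      have h2 := abs_max_sub_max_le_abs (1 - ‖x - c‖ / r) (1 - ‖y - c‖ / r) 0
      rw [max_comm, max_comm _ (0 : ℝ)] at h2
      have h3 := abs_norm_sub_norm_le (y - c) (x - c)
      have h4 : 1 - ‖x - c‖ / r - (1 - ‖y - c‖ / r) = (‖y - c‖ - ‖x - c‖) / r := by ring
      rw [h4, abs_div, abs_of_pos hr] at h2
      have h5 : y - c - (x - c) = y - x := by ring
      rw [h5, norm_sub_rev y x] at h3
      refine h2.trans ?_
      exact div_le_div_of_nonneg_right h3 hr.le
    calc _ ≤ ‖x - y‖ / r * ‖q - c‖ := by gcongr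
      _ = _ := by rw [hC]; ring
  have hN : Subsingleton ℂ ∨ C <
      ‖(((ContinuousLinearEquiv.refl ℝ ℂ).symm : ℂ ≃L[ℝ] ℂ) : ℂ →L[ℝ] ℂ)‖₊⁻¹ := by
    right
    have : ‖(((ContinuousLinearEquiv.refl ℝ ℂ).symm : ℂ ≃L[ℝ] ℂ) : ℂ →L[ℝ] ℂ)‖₊ = 1 := by
      simp
    rw [this, inv_one]
    rw [← NNReal.coe_lt_coe]
    rw [hC, NNReal.coe_one]
    rwa [div_lt_one hr]
  have hfx : ∀ x, hA.toHomeomorph f hN x = f x := fun x => rfl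
  refine ⟨hA.toHomeomorph f hN, ?_, ?_⟩
  · rw [hfx]; simp [f]
  · intro x hx
    rw [hfx]
    have : r ≤ ‖x - c‖ := by rw [mem_ball, dist_eq_norm, not_lt] at hx; exact hx
    have h1 : 1 - ‖x - c‖ / r ≤ 0 := by
      rw [sub_nonpos, le_div_iff₀ hr]; linarith
    simp [f, max_eq_left h1]

/-- `S` lies in the interior of a tame closed disk contained in `V`. -/
def InDisk (V S : Set ℂ) : Prop :=
  ∃ g : ℂ ≃ₜ ℂ, g '' closedBall 0 1 ⊆ V ∧ S ⊆ g '' ball 0 1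

lemma InDisk.mono {V S T : Set ℂ} (h : InDisk V S) (hT : T ⊆ S) : InDisk V T := by
  obtain ⟨g, h1, h2⟩ := h
  exact ⟨g, h1, hT.trans h2⟩

lemma inDisk_singleton {V : Set ℂ} (hV : IsOpen V) {q : ℂ} (hq : q ∈ V) : InDisk V {q} := by
  obtain ⟨r, hr, hB⟩ := Metric.isOpen_iff.1 hV q hq
  have hr2 : ((r / 2 : ℝ) : ℂ) ≠ 0 := by exact_mod_cast (by positivity)
  refine ⟨(Homeomorph.mulLeft₀ ((r / 2 : ℝ) : ℂ) hr2).trans (Homeomorph.addLeft q), ?_, ?_⟩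
  · rintro _ ⟨w, hw, rfl⟩
    apply hB
    have hw' : ‖w‖ ≤ 1 := by simpa using hw
    have : ‖((r / 2 : ℝ) : ℂ) * w‖ < r := by
      rw [norm_mul, Complex.norm_real, Real.norm_eq_abs, abs_of_pos (by positivity)]
      nlinarith
    rw [mem_ball, dist_eq_norm]
    simpa using this
  · rintro x rfl
    exact ⟨0, by simp, by simp⟩

lemma inDisk_insert {V : Set ℂ} (hV : IsOpen V) (hVc : IsPreconnected V) {S : Set ℂ}
    (hSf : S.Finite) {x y : ℂ} (hx : x ∈ V) (hy : y ∈ V) (h : InDisk V (insert x S)) :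
    InDisk V (insert y S) := by
  refine hVc.induction₂' (fun x y => InDisk V (insert x S) → InDisk V (insert y S)) ?_ ?_ hx hy h
  · intro x hx
    apply Filter.Eventually.and
    · by_cases hQ : InDisk V (insert x S)
      · obtain ⟨g, h1, h2⟩ := hQ
        have ho : IsOpen (g '' ball 0 1) := g.isOpenMap _ isOpen_ball
        have := ho.mem_nhds (h2 (mem_insert _ _))
        filter_upwards [mem_nhdsWithin_of_mem_nhds this] with y hy _
        exact ⟨g, h1, insert_subset hy ((subset_insert _ _).trans h2)⟩
      · exact Filter.Eventually.of_forall fun y h => absurd h hQ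
    · by_cases hxS : x ∈ S
      · refine Filter.Eventually.of_forall fun y h => h.mono ?_
        rw [insert_eq_of_mem hxS]; exact subset_insert _ _
      · obtain ⟨r, hr, hB⟩ := Metric.isOpen_iff.1 (hV.inter hSf.isClosed.isOpen_compl) x ⟨hx, hxS⟩
        filter_upwards [mem_nhdsWithin_of_mem_nhds (ball_mem_nhds x hr)] with y hy h
        obtain ⟨m, hm, hmo⟩ := ball_move x y r hr hy
        obtain ⟨g, h1, h2⟩ := h
        have hmo' : ∀ w, w ∉ ball x r → m.symm w = w := fun w hw => by
          rw [Homeomorph.symm_apply_eq, hmo w hw]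
        refine ⟨g.trans m.symm, ?_, ?_⟩
        · rintro _ ⟨w, hw, rfl⟩
          by_cases hw2 : g w ∈ ball x r
          · have : m.symm (g w) ∈ ball x r := by
              by_contra hcon
              have := hmo _ hcon
              rw [Homeomorph.apply_symm_apply] at this
              rw [← this] at hcon
              exact hcon hw2
            exact (hB this).1
          · simp only [Homeomorph.trans_apply]
            rw [hmo' _ hw2]
            exact h1 ⟨w, hw, rfl⟩
        · rintro w (rfl | hw)
          · obtain ⟨v, hv, hv'⟩ := h2 (mem_insert _ _)
            refine ⟨v, hv, ?_⟩
            simp only [Homeomorph.trans_apply]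
            rw [hv', Homeomorph.symm_apply_eq, hm]
          · obtain ⟨v, hv, hv'⟩ := h2 (mem_insert_of_mem _ hw)
            refine ⟨v, hv, ?_⟩
            simp only [Homeomorph.trans_apply]
            rw [hv', hmo' _ (fun hh => (hB hh).2 hw)]
  · intro x y z _ _ _ h1 h2 h
    exact h2 (h1 h)

lemma inDisk_finite {V : Set ℂ} (hV : IsOpen V) (hVc : IsConnected V) {S : Set ℂ}
    (hSf : S.Finite) : S ⊆ V → InDisk V S := by
  induction S, hSf using Set.Finite.induction_on with
  | empty =>
    intro _
    obtain ⟨q, hq⟩ := hVc.nonempty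
    exact (inDisk_singleton hV hq).mono (empty_subset _)
  | @insert a S _ hS ih =>
    intro hsub
    have ha : a ∈ V := hsub (mem_insert _ _)
    rcases S.eq_empty_or_nonempty with rfl | ⟨x, hx⟩
    · simpa using inDisk_singleton hV ha
    · have hSV := (subset_insert _ _).trans hsub
      refine inDisk_insert hV hVc.isPreconnected hS (hSV hx) ha ?_
      rw [insert_eq_of_mem hx]
      exact ih hSV

/-- Version in the disk. -/
lemma exists_disk (V : Set ↥Disk) (hV : IsOpen V) (hVc : IsConnected V) (S : Set ↥Disk)
    (hSf : S.Finite) (hSV : S ⊆ V) :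
    ∃ U D : Set ↥Disk, IsOpenDisk U ∧ IsClosedDisk D ∧ S ⊆ U ∧ U ⊆ D ∧ D ⊆ V := by
  have hop : IsOpenEmbedding (Subtype.val : ↥Disk → ℂ) := isOpen_ball.isOpenEmbedding_subtypeVal
  obtain ⟨g, h1, h2⟩ := inDisk_finite (hop.isOpenMap V hV)
    (hVc.image _ continuous_subtype_val.continuousOn) (hSf.image Subtype.val)
    (image_mono hSV)
  have hmem : ∀ w ∈ closedBall (0 : ℂ) 1, g w ∈ Disk := fun w hw => by
    obtain ⟨v, _, hv⟩ := h1 ⟨w, hw, rfl⟩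
    rw [← hv]; exact v.2
  have hmem' : ∀ w ∈ ball (0 : ℂ) 1, g w ∈ Disk := fun w hw => hmem w (ball_subset_closedBall hw)
  refine ⟨Subtype.val ⁻¹' (g '' ball 0 1), Subtype.val ⁻¹' (g '' closedBall 0 1), ⟨?_, ⟨?_⟩⟩, ⟨?_⟩,
    ?_, ?_, ?_⟩
  · exact (g.isOpenMap _ isOpen_ball).preimage continuous_subtype_val
  · exact
    { toFun := fun x => ⟨g.symm x.1.1, by
        obtain ⟨w, hw, hw'⟩ := x.2
        rw [← hw', Homeomorph.symm_apply_apply]; exact hw⟩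
      invFun := fun w => ⟨⟨g w.1, hmem' _ w.2⟩, ⟨w.1, w.2, rfl⟩⟩
      left_inv := fun x => by simp
      right_inv := fun x => by simp
      continuous_toFun := by fun_prop
      continuous_invFun := by fun_prop }
  · exact
    { toFun := fun x => ⟨g.symm x.1.1, by
        obtain ⟨w, hw, hw'⟩ := x.2
        rw [← hw', Homeomorph.symm_apply_apply]; exact hw⟩
      invFun := fun w => ⟨⟨g w.1, hmem _ w.2⟩, ⟨w.1, w.2, rfl⟩⟩
      left_inv := fun x => by simp
      right_inv := fun x => by simp
      continuous_toFun := by fun_prop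
      continuous_invFun := by fun_prop }
  · intro x hx
    exact h2 ⟨x, hx, rfl⟩
  · exact preimage_mono (image_mono ball_subset_closedBall)
  · intro x hx
    obtain ⟨v, hv, hv'⟩ := h1 hx
    rwa [← Subtype.ext hv']

lemma exists_disk_nhds (W : Set ↥Disk) (hW : IsOpen W) (K : Set ↥Disk) (hK : IsPreconnected K)
    (hKW : K ⊆ W) (S : Set ↥Disk) (hSf : S.Finite) (hSK : S ⊆ K) (hS : S.Nonempty) :
    ∃ U D : Set ↥Disk, IsOpenDisk U ∧ IsClosedDisk D ∧ S ⊆ U ∧ U ⊆ D ∧ D ⊆ W := by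
  have hop : IsOpenEmbedding (Subtype.val : ↥Disk → ℂ) := isOpen_ball.isOpenEmbedding_subtypeVal
  have : LocallyConnectedSpace ↥Disk := hop.locallyConnectedSpace
  obtain ⟨x, hx⟩ := hS
  have hxW := hKW (hSK hx)
  obtain ⟨U, D, a, b, c, d, e⟩ := exists_disk (connectedComponentIn W x) hW.connectedComponentIn
    (isConnected_connectedComponentIn_iff.2 hxW) S hSf
    (hSK.trans (hK.subset_connectedComponentIn (hSK hx) hKW))
  exact ⟨U, D, a, b, c, d, e.trans (connectedComponentIn_subset _ _)⟩

lemma IsClosedDisk.isCompact {D : Set ↥Disk} (hD : IsClosedDisk D) : IsCompact D := by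
  obtain ⟨h⟩ := hD
  have : CompactSpace (closedBall (0 : ℂ) 1) := isCompact_iff_compactSpace.1 (isCompact_closedBall _ _)
  have : CompactSpace D := h.symm.compactSpace
  exact isCompact_iff_compactSpace.2 this

lemma IsClosedDisk.interior_of {D : Set ↥Disk} (h : D ≃ₜ closedBall (0 : ℂ) 1)
    (a : closedBall (0 : ℂ) 1) (ha : ‖a.1‖ < 1) : (h.symm a).1 ∈ interior D := by
  have h1 := invariance (fun w => (h.symm w).1.1) (by fun_prop) (by
    intro x y hxy
    exact h.symm.injective (Subtype.ext (Subtype.ext hxy))) a ha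
  refine mem_interior.2 ⟨Subtype.val ⁻¹' _, ?_, isOpen_interior.preimage continuous_subtype_val, h1⟩
  intro x hx
  obtain ⟨b, hb⟩ := interior_subset hx
  rw [← Subtype.ext hb]
  exact (h.symm b).2

lemma IsClosedDisk.joined {D : Set ↥Disk} (hD : IsClosedDisk D) {x y : ↥Disk} (hx : x ∈ D)
    (hy : y ∈ D) : ∃ K ⊆ D, IsCompact K ∧ IsPreconnected K ∧ x ∈ K ∧ y ∈ K ∧
      ∀ p ∈ K, p = x ∨ p = y ∨ p ∈ interior D := by
  obtain ⟨h⟩ := hD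
  set a := h ⟨x, hx⟩ with ha
  set b := h ⟨y, hy⟩ with hb
  have hmem : ∀ t : unitInterval, AffineMap.lineMap a.1 b.1 (t : ℝ) ∈ closedBall (0 : ℂ) 1 :=
    fun t => (convex_closedBall (0 : ℂ) 1).lineMap_mem a.2 b.2 t.2
  let F : unitInterval → ↥Disk := fun t => (h.symm ⟨_, hmem t⟩).1
  have hF : Continuous F := by
    have : Continuous fun t : unitInterval => AffineMap.lineMap a.1 b.1 (t : ℝ) :=
      AffineMap.lineMap_continuous.comp continuous_subtype_val
    exact continuous_subtype_val.comp (h.symm.continuous.comp (this.subtype_mk _))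
  have F0 : F 0 = x := by simp [F, ha]
  have F1 : F 1 = y := by simp [F, hb]
  refine ⟨range F, ?_, isCompact_range hF, isPreconnected_range hF, ⟨0, F0⟩, ⟨1, F1⟩, ?_⟩
  · rintro _ ⟨t, rfl⟩
    exact (h.symm _).2
  · rintro _ ⟨t, rfl⟩
    by_cases hab : a = b
    · left
      simp [F, hab, hb]
      have : (⟨x, hx⟩ : D) = ⟨y, hy⟩ := h.injective hab
      exact (congrArg Subtype.val this).symm
    by_cases h0 : t = 0
    · left; rw [h0, F0]
    by_cases h1 : t = 1
    · right; left; rw [h1, F1]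
    right; right
    apply IsClosedDisk.interior_of
    have ht0 : 0 < (t : ℝ) := lt_of_le_of_ne t.2.1 (fun hh => h0 (Subtype.ext hh.symm))
    have ht1 : (t : ℝ) < 1 := lt_of_le_of_ne t.2.2 (fun hh => h1 (Subtype.ext hh))
    have := strictConvex_closedBall ℝ (0 : ℂ) 1 a.2 b.2 (fun hh => hab (Subtype.ext hh))
      (a := 1 - (t : ℝ)) (b := t) (by linarith) ht0 (by ring)
    rw [interior_closedBall _ one_ne_zero, mem_ball_zero_iff] at this
    rw [← AffineMap.lineMap_apply_module] at this
    exact this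

lemma IsClosedDisk.isPreconnected {D : Set ↥Disk} (hD : IsClosedDisk D) : IsPreconnected D := by
  refine isPreconnected_of_forall_pair fun x hx y hy => ?_
  obtain ⟨K, h1, _, h2, h3, h4, _⟩ := hD.joined hx hy
  exact ⟨K, h1, h3, h4, h2⟩

lemma IsClosedDisk.subset_closure {D : Set ↥Disk} (hD : IsClosedDisk D) :
    D ⊆ closure (interior D) := by
  intro x hx
  obtain ⟨h⟩ := hD
  set a := h ⟨x, hx⟩ with ha
  have han : ‖a.1‖ ≤ 1 := mem_closedBall_zero_iff.1 a.2
  have hn : ∀ t : unitInterval, ‖((t : ℝ) : ℂ) * a.1‖ ≤ t := fun t => by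
    rw [norm_mul, Complex.norm_real, Real.norm_eq_abs, abs_of_nonneg t.2.1]
    have := t.2.1
    nlinarith
  have hmem : ∀ t : unitInterval, ((t : ℝ) : ℂ) * a.1 ∈ closedBall (0 : ℂ) 1 :=
    fun t => by rw [mem_closedBall_zero_iff]; exact (hn t).trans t.2.2
  let F : unitInterval → ↥Disk := fun t => (h.symm ⟨_, hmem t⟩).1
  have hF : Continuous F := by
    have : Continuous fun t : unitInterval => ((t : ℝ) : ℂ) * a.1 := by fun_prop
    exact continuous_subtype_val.comp (h.symm.continuous.comp (this.subtype_mk _))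
  have F1 : F 1 = x := by simp [F, ha]
  have hcl : (1 : unitInterval) ∈ closure (Iio 1) := by
    rw [closure_Iio' ⟨0, by simp⟩]; simp
  rw [← F1]
  refine map_mem_closure hF hcl ?_
  intro t ht
  exact IsClosedDisk.interior_of h _ (lt_of_le_of_lt (hn t) ht)

lemma fiter_add (f : ↥Disk ≃ₜ ↥Disk) (a b : ℤ) (x : ↥Disk) :
    fiter f (a + b) x = fiter f a (fiter f b x) := by
  simp only [fiter]
  have := zpow_add (G := Equiv.Perm ↥Disk) f.toEquiv a b
  exact congrArg (fun e : Equiv.Perm ↥Disk => e x) this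

lemma fiter_one (f : ↥Disk ≃ₜ ↥Disk) (x : ↥Disk) : fiter f 1 x = f x := by
  simp only [fiter]
  exact congrArg (fun e : Equiv.Perm ↥Disk => e x) (zpow_one (G := Equiv.Perm ↥Disk) f.toEquiv)

lemma free_nhds (f : ↥Disk ≃ₜ ↥Disk) (K : Set ↥Disk) (hK : IsCompact K)
    (hfree : ∀ p ∈ K, f p ∉ K) :
    ∃ W, IsOpen W ∧ K ⊆ W ∧ ∀ p ∈ W, f p ∉ W := by
  have hd : Disjoint (f '' K) K := by
    rw [disjoint_left]
    rintro _ ⟨p, hp, rfl⟩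
    exact hfree p hp
  obtain ⟨U, V, hU, hV, hKU, hKV, hUV⟩ :=
    SeparatedNhds.of_isCompact_isCompact (hK.image f.continuous) hK hd
  refine ⟨f ⁻¹' U ∩ V, (hU.preimage f.continuous).inter hV, ?_, ?_⟩
  · intro p hp
    exact ⟨hKU ⟨p, hp, rfl⟩, hKV hp⟩
  · intro p hp hp'
    exact disjoint_left.1 hUV hp.1 hp'.2

lemma thick_sep {M ι : Type*} [PseudoMetricSpace M] (A B : ι → Set M) (R : ι → ι → Prop)
    (hA : ∀ i, IsCompact (A i)) (hB : ∀ i, IsCompact (B i)) (hAc : ∀ i, IsClosed (A i))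
    (hBc : ∀ i, IsClosed (B i))
    (lA : LocallyFinite A) (lB : LocallyFinite B)
    (hR : ∀ i j, R i j → Disjoint (A i) (B j)) :
    ∃ ε η : ι → ℝ, (∀ i, 0 < ε i) ∧ (∀ i, 0 < η i) ∧
      ∀ i j, R i j → Disjoint (thickening (ε i) (A i)) (thickening (η j) (B j)) := by
  have key : ∀ (A B : ι → Set M) (R : ι → ι → Prop), (∀ i, IsCompact (A i)) →
      (∀ i, IsClosed (B i)) → LocallyFinite B → (∀ i j, R i j → Disjoint (A i) (B j)) →
      ∀ i, ∃ δ > 0, ∀ j, R i j → ∀ a ∈ A i, ∀ b ∈ B j, δ ≤ dist a b := by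
    intro A B R hA hB lB hR i
    have hc : IsClosed (⋃ j : {j // R i j}, B j) :=
      (lB.comp_injective Subtype.val_injective).isClosed_iUnion fun j => hB j
    have hd : Disjoint (A i) (⋃ j : {j // R i j}, B j) := by
      rw [disjoint_iUnion_right]
      exact fun j => hR i j j.2
    obtain ⟨δ, hδ, h⟩ := hd.exists_thickenings (hA i) hc
    refine ⟨δ, hδ, fun j hj a ha b hb => ?_⟩
    by_contra hlt
    push Not at hlt
    refine absurd ?_ (disjoint_left.1 h (?_ : b ∈ _))
    · exact self_subset_thickening hδ _ (mem_iUnion.2 ⟨⟨j, hj⟩, hb⟩)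
    · rw [mem_thickening_iff]; exact ⟨a, ha, by rwa [dist_comm]⟩
  choose δ hδ h1 using key A B R hA hBc lB hR
  choose δ' hδ' h2 using key B A (fun i j => R j i) hB hAc lA (fun i j h => (hR j i h).symm)
  refine ⟨fun i => δ i / 2, fun i => δ' i / 2, fun i => half_pos (hδ i), fun i => half_pos (hδ' i), ?_⟩
  intro i j hij
  rw [disjoint_left]
  intro p hp hp'
  rw [mem_thickening_iff] at hp hp'
  obtain ⟨a, ha, ha'⟩ := hp
  obtain ⟨b, hb, hb'⟩ := hp'
  have e1 := h1 i j hij a ha b hb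
  have e2 := h2 j i hij b hb a ha
  rw [dist_comm] at e2
  have e3 := dist_triangle_left a b p
  linarith

lemma recurrent_of (f : ↥Disk ≃ₜ ↥Disk) (z : ↥Disk) (D' : ℤ → Set ↥Disk)
    (hdisk : ∀ k, IsClosedDisk (D' k))
    (hdisj : Pairwise fun k k' => Disjoint (D' k) (D' k'))
    (hmem : ∀ k, fiter f k z ∈ D' k)
    (hfix : ∀ k, ∀ x ∈ D' k, f x ≠ x)
    (hint : ∀ k, (⇑f '' interior (D' k)) ∩ interior (D' k) = ∅)
    {k k' : ℤ} (hk : k' < k) {n : ℤ} (hn : 1 ≤ n) {x : ↥Disk} (hx : x ∈ D' k)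
    (hy : fiter f n x ∈ D' k') : RecurrentHomeo f := by
  have hint1 : ∀ k, ∀ p ∈ interior (D' k), f p ∉ D' k := by
    intro k p hp hfp
    have h1 := (hdisk k).subset_closure hfp
    obtain ⟨q, hq, hq'⟩ := mem_closure_iff.1 h1 _ (f.isOpenMap _ isOpen_interior) ⟨p, hp, rfl⟩
    exact (eq_empty_iff_forall_notMem.1 (hint k)) q ⟨hq, hq'⟩
  have hint2 : ∀ k, ∀ p ∈ D' k, f p ∉ interior (D' k) := by
    intro k p hp hfp
    have h1 := (hdisk k).subset_closure hp
    obtain ⟨q, hq, hq'⟩ := mem_closure_iff.1 h1 _ (isOpen_interior.preimage f.continuous) hfp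
    exact (eq_empty_iff_forall_notMem.1 (hint k)) (f q) ⟨⟨q, hq', rfl⟩, hq⟩
  have hz : ∀ k, f (fiter f k z) = fiter f (k + 1) z := by
    intro k
    rw [add_comm, fiter_add, fiter_one]
  have hz1 : ∀ k, f (fiter f k z) ∉ D' k := by
    intro k h
    rw [hz] at h
    exact disjoint_left.1 (hdisj (show k + 1 ≠ k by omega)) (hmem (k + 1)) h
  have hz2 : ∀ k, ∀ p ∈ D' k, f p ≠ fiter f k z := by
    intro k p hp h
    have h1 := hz (k - 1)
    rw [sub_add_cancel, ← h] at h1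
    have h2 := f.injective h1
    have h3 := hmem (k - 1)
    rw [h2] at h3
    exact disjoint_left.1 (hdisj (show k - 1 ≠ k by omega)) h3 hp
  have hKK : ∀ k, ∀ u ∈ D' k, ∃ K ⊆ D' k, IsCompact K ∧ IsPreconnected K ∧ u ∈ K ∧
      fiter f k z ∈ K ∧ ∀ p ∈ K, f p ∉ K := by
    intro k u hu
    obtain ⟨K, h1, h2, h3, h4, h5, h6⟩ := (hdisk k).joined hu (hmem k)
    refine ⟨K, h1, h2, h3, h4, h5, ?_⟩
    intro p hp hfp
    rcases h6 p hp with rfl | rfl | hpi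
    · rcases h6 _ hfp with e | e | e
      · exact hfix k _ hu e
      · exact hz2 k _ (h1 hp) e
      · exact hint2 k _ (h1 hp) e
    · exact hz1 k (h1 hfp)
    · exact hint1 k p hpi (h1 hfp)
  obtain ⟨K, hKD, hKc, hKp, hxK, hzK, hKf⟩ := hKK k x hx
  obtain ⟨K', hKD', hKc', hKp', hyK', hzK', hKf'⟩ := hKK k' _ hy
  obtain ⟨W, hW, hKW, hWf⟩ := free_nhds f K hKc hKf
  obtain ⟨W', hW', hKW', hWf'⟩ := free_nhds f K' hKc' hKf'
  obtain ⟨O, O', hO, hO', hKO, hKO', hOO⟩ := SeparatedNhds.of_isCompact_isCompact hKc hKc'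
    ((hdisj hk.ne').mono hKD hKD')
  obtain ⟨U, D, hU, -, hSU, hUD, hDW⟩ := exists_disk_nhds (W ∩ O) (hW.inter hO) K hKp
    (subset_inter hKW hKO) {x, fiter f k z} (by simp) (by rintro p (rfl | rfl) <;> assumption)
    ⟨x, by simp⟩
  obtain ⟨U', D1, hU', -, hSU', hUD', hDW'⟩ := exists_disk_nhds (W' ∩ O') (hW'.inter hO') K' hKp'
    (subset_inter hKW' hKO') {fiter f n x, fiter f k' z} (by simp)
    (by rintro p (rfl | rfl) <;> assumption) ⟨fiter f n x, by simp⟩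
  have hfU : IsFreeSet f U := by
    rw [IsFreeSet, eq_empty_iff_forall_notMem]
    rintro _ ⟨⟨p, hp, rfl⟩, hp'⟩
    exact hWf p (hDW (hUD hp)).1 (hDW (hUD hp')).1
  have hfU' : IsFreeSet f U' := by
    rw [IsFreeSet, eq_empty_iff_forall_notMem]
    rintro _ ⟨⟨p, hp, rfl⟩, hp'⟩
    exact hWf' p (hDW' (hUD' hp)).1 (hDW' (hUD' hp')).1
  have hUU : Disjoint U U' :=
    hOO.mono (fun p hp => (hDW (hUD hp)).2) (fun p hp => (hDW' (hUD' hp)).2)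
  have c1 : ∃ j : ℤ, 1 ≤ j ∧ ((fiter f j '' U) ∩ U').Nonempty :=
    ⟨n, hn, fiter f n x, ⟨x, hSU (by simp), rfl⟩, hSU' (by simp)⟩
  have c2 : ∃ j : ℤ, 1 ≤ j ∧ ((fiter f j '' U') ∩ U).Nonempty := by
    refine ⟨k - k', by omega, fiter f k z, ⟨fiter f k' z, hSU' (by simp), ?_⟩, hSU (by simp)⟩
    rw [← fiter_add, sub_add_cancel]
  have two : ∀ i : ZMod 2, i = 0 ∨ i = 1 := by decide
  have h01 : (1 : ZMod 2) ≠ 0 := by decide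
  have h11 : (1 + 1 : ZMod 2) = 0 := by decide
  refine ⟨2, by norm_num, fun i => if i = 0 then U else U', ?_, ?_, ?_, ?_⟩
  · intro i
    rcases two i with rfl | rfl
    · simpa using hU
    · simpa [h01] using hU'
  · intro i
    rcases two i with rfl | rfl
    · simpa using hfU
    · simpa [h01] using hfU'
  · intro i j hij
    rcases two i with rfl | rfl <;> rcases two j with rfl | rfl
    · exact absurd rfl hij
    · simpa [h01] using hUU
    · simpa [h01] using hUU.symm
    · exact absurd rfl hij
  · intro i
    rcases two i with rfl | rfl
    · simpa only [zero_add, if_true, if_neg h01] using c1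
    · simpa only [h11, if_true, if_neg h01] using c2

lemma locallyFinite_of (A : ℤ → Set ↥Disk) (α ω : ℂ) (hα : α ∈ Metric.sphere (0:ℂ) 1)
    (hω : ω ∈ Metric.sphere (0:ℂ) 1) (hm : TendstoSetsBot A α) (hp : TendstoSetsTop A ω) :
    LocallyFinite A := by
  intro x
  have hx : ‖x.1‖ < 1 := mem_ball_zero_iff.1 x.2
  set r := (1 - ‖x.1‖) / 2 with hr
  have hr0 : 0 < r := by linarith
  obtain ⟨N, hN⟩ := hm r hr0
  obtain ⟨M, hM⟩ := hp r hr0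
  refine ⟨ball x r, ball_mem_nhds x hr0, (Set.finite_Icc N M).subset ?_⟩
  have far : ∀ β ∈ sphere (0 : ℂ) 1, ∀ y ∈ ball x r, ¬ dist y.1 β < r := by
    intro β hβ y hy h
    have h1 : dist y.1 x.1 < r := hy
    have h2 : ‖β‖ = 1 := by simpa using hβ
    have h3 := dist_triangle_left β x.1 y.1
    have h4 := norm_sub_norm_le β x.1
    rw [← dist_eq_norm] at h4
    linarith
  rintro k ⟨y, hy, hy'⟩
  constructor
  · by_contra hlt
    exact far α hα y hy' (hN k (by omega) y hy)
  · by_contra hlt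
    exact far ω hω y hy' (hM k (by omega) y hy)

lemma small_aux : ∀ ε > (0 : ℝ), ∃ N : ℤ, 0 < N ∧ ∀ k : ℤ, N ≤ |k| →
    1 / (|(k : ℝ)| + 1) < ε := by
  intro ε hε
  obtain ⟨N, hN⟩ := exists_nat_gt (1 / ε)
  refine ⟨N + 1, by positivity, fun k hk => ?_⟩
  have h1 : ((N : ℝ) + 1) ≤ |(k : ℝ)| := by exact_mod_cast hk
  rw [div_lt_iff₀ (by positivity)]
  rw [div_lt_iff₀ hε] at hN
  nlinarith

/-- Lemma 3.4 (derived from the conclusion of Lemma 3.3). -/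
theorem handel_lem_3_4 (f : ↥Disk ≃ₜ ↥Disk) (z : ↥Disk) (α ω : ℂ)
    (hα : α ∈ Metric.sphere (0:ℂ) 1) (hω : ω ∈ Metric.sphere (0:ℂ) 1) (hαω : α ≠ ω)
    (D' : ℤ → Set ↥Disk)
    (hdisk : ∀ k, IsClosedDisk (D' k))
    (hdisj : Pairwise fun k k' => Disjoint (D' k) (D' k'))
    (hmem : ∀ k, fiter f k z ∈ frontier (D' k))
    (hfix : ∀ k, ∀ x ∈ D' k, f x ≠ x)
    (hmeet : ∀ k, ((⇑f '' D' k) ∩ D' k).Nonempty)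
    (hint : ∀ k, (⇑f '' interior (D' k)) ∩ interior (D' k) = ∅)
    (hconvₘ : TendstoSetsBot D' α) (hconvₚ : TendstoSetsTop D' ω) :
    RecurrentHomeo f ∨
      ∃ D : ℤ → Set ↥Disk,
        (∀ k, IsClosedDisk (D k)) ∧
        (Pairwise fun k k' => Disjoint (D k) (D k')) ∧
        (∀ k, fiter f k z ∈ interior (D k)) ∧
        (∀ k, ∀ x ∈ D k, f x ≠ x) ∧
        (∀ k, ((⇑f '' D k) ∩ D k).Nonempty) ∧
        (∀ k k' : ℤ, k' < k →
          (⇑f '' D k) ∩ D k' = ∅ ∧ (⇑f '' (⇑f '' D k)) ∩ D k' = ∅) ∧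
        TendstoSetsBot D α ∧ TendstoSetsTop D ω := by
  by_cases hrec : RecurrentHomeo f
  · exact Or.inl hrec
  right
  have hcomp : ∀ k, IsCompact (D' k) := fun k => (hdisk k).isCompact
  have hcl : ∀ k, IsClosed (D' k) := fun k => (hcomp k).isClosed
  have hmem' : ∀ k, fiter f k z ∈ D' k := fun k => by
    have := frontier_subset_closure (hmem k)
    rwa [(hcl k).closure_eq] at this
  have lf : LocallyFinite D' := locallyFinite_of D' α ω hα hω hconvₘ hconvₚ
  have lfim : ∀ A : ℤ → Set ↥Disk, LocallyFinite A → LocallyFinite (fun k => f '' A k) := by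
    intro A hA
    have := hA.preimage_continuous f.symm.continuous
    convert this using 2 with k
    exact f.image_eq_preimage_symm _
  have d1 : ∀ k k', k' < k → Disjoint (f '' D' k) (D' k') := by
    intro k k' hk
    rw [disjoint_left]
    rintro _ ⟨x, hx, rfl⟩ h
    refine hrec (recurrent_of f z D' hdisk hdisj hmem' hfix hint hk (n := 1) le_rfl hx ?_)
    rwa [fiter_one]
  have d2 : ∀ k k', k' < k → Disjoint (f '' (f '' D' k)) (D' k') := by
    intro k k' hk
    rw [disjoint_left]
    rintro _ ⟨_, ⟨x, hx, rfl⟩, rfl⟩ h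
    refine hrec (recurrent_of f z D' hdisk hdisj hmem' hfix hint hk (n := 1 + 1) (by norm_num) hx ?_)
    rwa [fiter_add, fiter_one, fiter_one]
  have c1 : ∀ k, IsCompact (f '' D' k) := fun k => (hcomp k).image f.continuous
  have c2 : ∀ k, IsCompact (f '' (f '' D' k)) := fun k => (c1 k).image f.continuous
  obtain ⟨ε₀, η₀, hε₀, hη₀, s₀⟩ := thick_sep D' D' (fun k k' => k ≠ k') hcomp hcomp hcl hcl lf lf
    (fun k k' h => hdisj h)
  obtain ⟨ε₁, η₁, hε₁, hη₁, s₁⟩ := thick_sep (fun k => f '' D' k) D' (fun k k' => k' < k) c1 hcomp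
    (fun k => (c1 k).isClosed) hcl (lfim _ lf) lf d1
  obtain ⟨ε₂, η₂, hε₂, hη₂, s₂⟩ := thick_sep (fun k => f '' (f '' D' k)) D' (fun k k' => k' < k) c2
    hcomp (fun k => (c2 k).isClosed) hcl (lfim _ (lfim _ lf)) lf d2
  have hτ : ∀ k : ℤ, (0 : ℝ) < 1 / (|(k : ℝ)| + 1) := fun k => by positivity
  have hex : ∀ k, ∃ U D : Set ↥Disk, IsOpenDisk U ∧ IsClosedDisk D ∧ U ⊆ D ∧ fiter f k z ∈ U ∧
      ((⇑f '' D) ∩ D).Nonempty ∧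
      D ⊆ thickening (ε₀ k) (D' k) ∧ D ⊆ thickening (η₀ k) (D' k) ∧
      D ⊆ f ⁻¹' thickening (ε₁ k) (f '' D' k) ∧ D ⊆ thickening (η₁ k) (D' k) ∧
      D ⊆ f ⁻¹' (f ⁻¹' thickening (ε₂ k) (f '' (f '' D' k))) ∧ D ⊆ thickening (η₂ k) (D' k) ∧
      D ⊆ {x | f x ≠ x} ∧ D ⊆ thickening (1 / (|(k : ℝ)| + 1)) (D' k) := by
    intro k
    obtain ⟨_, ⟨w, hw, rfl⟩, hfw⟩ := hmeet k
    have ho : IsOpen {x | f x ≠ x} := isOpen_ne_fun f.continuous continuous_id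
    have m1 : ∀ x ∈ D' k, f x ∈ thickening (ε₁ k) (f '' D' k) := fun x hx =>
      self_subset_thickening (hε₁ k) (f '' D' k) (mem_image_of_mem f hx)
    have m2 : ∀ x ∈ D' k, f (f x) ∈ thickening (ε₂ k) (f '' (f '' D' k)) := fun x hx =>
      self_subset_thickening (hε₂ k) (f '' (f '' D' k))
        (mem_image_of_mem f (mem_image_of_mem f hx))
    obtain ⟨U, D, hU, hD, hSU, hUD, hDW⟩ := exists_disk_nhds
      (thickening (ε₀ k) (D' k) ∩ (thickening (η₀ k) (D' k) ∩
        (f ⁻¹' thickening (ε₁ k) (f '' D' k) ∩ (thickening (η₁ k) (D' k) ∩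
        (f ⁻¹' (f ⁻¹' thickening (ε₂ k) (f '' (f '' D' k))) ∩ (thickening (η₂ k) (D' k) ∩
        ({x | f x ≠ x} ∩ thickening (1 / (|(k : ℝ)| + 1)) (D' k))))))))
      (isOpen_thickening.inter (isOpen_thickening.inter
        ((isOpen_thickening.preimage f.continuous).inter (isOpen_thickening.inter
        (((isOpen_thickening.preimage f.continuous).preimage f.continuous).inter
        (isOpen_thickening.inter (ho.inter isOpen_thickening)))))))
      (D' k) (hdisk k).isPreconnected
      (fun x hx => ⟨self_subset_thickening (hε₀ k) _ hx, self_subset_thickening (hη₀ k) _ hx,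
        m1 x hx, self_subset_thickening (hη₁ k) _ hx,
        m2 x hx,
        self_subset_thickening (hη₂ k) _ hx, hfix k x hx,
        self_subset_thickening (hτ k) _ hx⟩)
      {fiter f k z, w, f w} (by simp)
      (by
        rintro p (rfl | rfl | rfl)
        · exact hmem' k
        · exact hw
        · exact hfw) ⟨w, by simp⟩
    simp only [subset_inter_iff] at hDW
    exact ⟨U, D, hU, hD, hUD, hSU (by simp),
      ⟨f w, ⟨w, hUD (hSU (by simp)), rfl⟩, hUD (hSU (by simp))⟩, hDW⟩
  choose U D hU hD hUD hzU hmt t1 t2 t3 t4 t5 t6 t7 t8 using hex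
  have near : ∀ k, ∀ x ∈ D k, ∃ y ∈ D' k, dist x.1 y.1 < 1 / (|(k : ℝ)| + 1) := by
    intro k x hx
    exact (mem_thickening_iff.1 (t8 k hx))
  refine ⟨D, hD, ?_, ?_, ?_, hmt, ?_, ?_, ?_⟩
  · intro k k' h
    exact (s₀ k k' h).mono (t1 k) (t2 k')
  · intro k
    exact mem_interior.2 ⟨U k, hUD k, (hU k).1, hzU k⟩
  · intro k x hx
    exact t7 k hx
  · intro k k' h
    constructor
    · rw [eq_empty_iff_forall_notMem]
      rintro _ ⟨⟨x, hx, rfl⟩, hx'⟩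
      exact disjoint_left.1 (s₁ k k' h) (t3 k hx) (t4 k' hx')
    · rw [eq_empty_iff_forall_notMem]
      rintro _ ⟨⟨_, ⟨x, hx, rfl⟩, rfl⟩, hx'⟩
      exact disjoint_left.1 (s₂ k k' h) (t5 k hx) (t6 k' hx')
  · intro ε hε
    obtain ⟨N, hN⟩ := hconvₘ (ε / 2) (by positivity)
    obtain ⟨M, hM0, hM⟩ := small_aux (ε / 2) (by positivity)
    refine ⟨min N (-M), fun k hk x hx => ?_⟩
    obtain ⟨y, hy, hxy⟩ := near k x hx
    have h1 := hN k (hk.trans (min_le_left _ _)) y hy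
    have h2 := hM k (by have := hk.trans (min_le_right _ _); rw [abs_of_neg (by omega)]; omega)
    have h3 := dist_triangle x.1 y.1 α
    linarith
  · intro ε hε
    obtain ⟨N, hN⟩ := hconvₚ (ε / 2) (by positivity)
    obtain ⟨M, hM0, hM⟩ := small_aux (ε / 2) (by positivity)
    refine ⟨max N M, fun k hk x hx => ?_⟩
    obtain ⟨y, hy, hxy⟩ := near k x hx
    have h1 := hN k ((le_max_left _ _).trans hk) y hy
    have h2 := hM k (by have := (le_max_right _ _).trans hk; rw [abs_of_pos (by omega)]; omega)
    have h3 := dist_triangle x.1 y.1 ω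
    linarith
end
end
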